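/- arXiv:math/0209333 — 3 statements merged into one kernel-verified Lean document; each statement's English description precedes it below -/
import Mathlib

section
/- (Hasse principle for rational equivalence) Let L and M be even lattices. The rational quadratic spaces L⊗ℚ and M⊗ℚ are isometric if and only if for every prime p the quadratic spaces L⊗ℚ_p and M⊗ℚ_p over the field ℚ_p of p-adic numbers are isometric and the real quadratic spaces L⊗ℝ and M⊗ℝ are isometric. -/
open scoped BigOperators

noncomputable section

/-- The group `ℚ/ℤ`. -/
abbrev QmodZ : Type := ℚ ⧸ AddSubgroup.zmultiples (1 : ℚ)

/-- The group `ℚ/2ℤ`. -/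
abbrev Qmod2Z : Type := ℚ ⧸ AddSubgroup.zmultiples (2 : ℚ)

/-- The isomorphism `ℚ/2ℤ → ℚ/ℤ` induced by dividing by `2`. -/
noncomputable def halfHom : Qmod2Z →+ QmodZ :=
  QuotientAddGroup.map _ _ (AddMonoidHom.mk' (fun x : ℚ => x / 2) (fun a b => add_div a b 2))
    (by
      intro x hx
      obtain ⟨k, rfl⟩ := AddSubgroup.mem_zmultiples_iff.mp hx
      refine AddSubgroup.mem_zmultiples_iff.mpr ⟨k, ?_⟩
      show k • (1:ℚ) = (k • (2:ℚ)) / 2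
      push_cast [zsmul_eq_mul]
      ring)

/-- The bilinear form `b(x,y) = (q(x+y) - q(x) - q(y))/2 ∈ ℚ/ℤ` associated to
`q : A → ℚ/2ℤ`. -/
def bForm {A : Type*} [AddCommGroup A] (q : A → Qmod2Z) (x y : A) : QmodZ :=
  halfHom (q (x + y) - q x - q y)

/-- `q : A → ℚ/2ℤ` is a finite quadratic space structure on the finite abelian group `A`
if the associated form `b` is `ℤ`-bilinear (i.e. biadditive) and nondegenerate. -/
structure IsFiniteQuadraticSpace {A : Type*} [AddCommGroup A] [Finite A]
    (q : A → Qmod2Z) : Prop where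
  add_left : ∀ x x' y, bForm q (x + x') y = bForm q x y + bForm q x' y
  add_right : ∀ x y y', bForm q x (y + y') = bForm q x y + bForm q x y'
  nondeg : ∀ x, (∀ y, bForm q x y = 0) → x = 0

/-- Two quadratic forms are isometric if some group isomorphism carries one to the other. -/
def FQSIsometric {A B : Type*} [AddCommGroup A] [AddCommGroup B]
    (qA : A → Qmod2Z) (qB : B → Qmod2Z) : Prop :=
  ∃ e : A ≃+ B, ∀ x, qB (e x) = qA x

/-- An even lattice, given by its rank and Gram matrix: the Gram matrix is symmetric,
has even diagonal (so `(x,x)` is always even) and is nondegenerate. -/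
structure EvenLattice : Type where
  n : ℕ
  B : Matrix (Fin n) (Fin n) ℤ
  symm : B.IsSymm
  even_diag : ∀ i, 2 ∣ B i i
  nondeg : B.det ≠ 0

/-- The bilinear form of `L` extended to `R^n` for any commutative ring `R ⊇ ℤ`. -/
def formR (L : EvenLattice) (R : Type*) [CommRing R] (x y : Fin L.n → R) : R :=
  ∑ i, ∑ j, (L.B i j : R) * x i * y j

theorem formR_zero_left (L : EvenLattice) (R : Type*) [CommRing R] (y : Fin L.n → R) :
    formR L R 0 y = 0 := by
  simp [formR]

theorem formR_add_left (L : EvenLattice) (R : Type*) [CommRing R] (x x' y : Fin L.n → R) :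
    formR L R (x + x') y = formR L R x y + formR L R x' y := by
  simp [formR, mul_add, add_mul, Finset.sum_add_distrib]

theorem formR_neg_left (L : EvenLattice) (R : Type*) [CommRing R] (x y : Fin L.n → R) :
    formR L R (-x) y = -formR L R x y := by
  simp [formR, Finset.sum_neg_distrib]

/-- `L` and `M` are isometric over `R`. -/
def IsometricOver (R : Type*) [CommRing R] (L M : EvenLattice) : Prop :=
  ∃ e : (Fin L.n → R) ≃ₗ[R] (Fin M.n → R), ∀ x y, formR M R (e x) (e y) = formR L R x y

/-- `L` and `M` lie in the same genus: they are isometric over `ℤ_p` for all primes `p`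
and over `ℝ`. -/
def SameGenus (L M : EvenLattice) : Prop :=
  (∀ (p : ℕ) [Fact p.Prime], IsometricOver ℤ_[p] L M) ∧ IsometricOver ℝ L M

/-- The subgroup of integral vectors in `ℚ^n`, i.e. the lattice `L` itself inside `L ⊗ ℚ`. -/
def intSub (L : EvenLattice) : AddSubgroup (Fin L.n → ℚ) where
  carrier := {x | ∀ i, ∃ m : ℤ, x i = m}
  zero_mem' := fun i => ⟨0, by simp⟩
  add_mem' := by
    intro x y hx hy i
    obtain ⟨mx, hmx⟩ := hx i
    obtain ⟨my, hmy⟩ := hy i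
    exact ⟨mx + my, by simp [hmx, hmy]⟩
  neg_mem' := by
    intro x hx i
    obtain ⟨m, hm⟩ := hx i
    exact ⟨-m, by simp [hm]⟩

/-- The dual lattice of a subgroup `K` of `L ⊗ ℚ`:
all vectors pairing integrally with every element of `K`. -/
def dualOf (L : EvenLattice) (K : AddSubgroup (Fin L.n → ℚ)) : AddSubgroup (Fin L.n → ℚ) where
  carrier := {x | ∀ y ∈ K, ∃ m : ℤ, formR L ℚ x y = m}
  zero_mem' := fun y _ => ⟨0, by simp [formR_zero_left]⟩
  add_mem' := by
    intro x x' hx hx' y hy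
    obtain ⟨m, hm⟩ := hx y hy
    obtain ⟨m', hm'⟩ := hx' y hy
    exact ⟨m + m', by rw [formR_add_left, hm, hm']; push_cast; ring⟩
  neg_mem' := by
    intro x hx y hy
    obtain ⟨m, hm⟩ := hx y hy
    exact ⟨-m, by rw [formR_neg_left, hm]; push_cast; ring⟩

/-- The dual lattice `L^*` of `L`. -/
abbrev dualSub (L : EvenLattice) : AddSubgroup (Fin L.n → ℚ) := dualOf L (intSub L)

/-- The discriminant group `K^*/K` of a subgroup `K` of `L ⊗ ℚ`. -/
abbrev discGroupOf (L : EvenLattice) (K : AddSubgroup (Fin L.n → ℚ)) : Type :=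
  dualOf L K ⧸ K.addSubgroupOf (dualOf L K)

/-- The discriminant group `L^*/L`. -/
abbrev discGroup (L : EvenLattice) : Type := discGroupOf L (intSub L)

/-- The discriminant form on `K^*/K`, `q(x + K) = (x,x) mod 2ℤ`
(defined via a choice of representative; it is independent of this choice). -/
noncomputable def discQOf (L : EvenLattice) (K : AddSubgroup (Fin L.n → ℚ)) :
    discGroupOf L K → Qmod2Z :=
  fun a => (QuotientAddGroup.mk (formR L ℚ (a.out : Fin L.n → ℚ) (a.out : Fin L.n → ℚ)) : Qmod2Z)

/-- The discriminant form `q_L` on `L^*/L`. -/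
noncomputable def discQ (L : EvenLattice) : discGroup L → Qmod2Z := discQOf L (intSub L)

/-- `n₊`: the maximal dimension of a positive definite subspace of `L ⊗ ℝ`. -/
noncomputable def sigPlus (L : EvenLattice) : ℕ :=
  sSup {d : ℕ | ∃ W : Submodule ℝ (Fin L.n → ℝ), Module.finrank ℝ W = d ∧
    ∀ x ∈ W, x ≠ 0 → 0 < formR L ℝ x x}

/-- `n₋`: the maximal dimension of a negative definite subspace of `L ⊗ ℝ`. -/
noncomputable def sigMinus (L : EvenLattice) : ℕ :=
  sSup {d : ℕ | ∃ W : Submodule ℝ (Fin L.n → ℝ), Module.finrank ℝ W = d ∧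
    ∀ x ∈ W, x ≠ 0 → formR L ℝ x x < 0}

end

namespace HasseW

open Matrix

set_option linter.unusedSectionVars false
set_option linter.unusedVariables false

/-! ### Matrix congruence -/

def Rep {K : Type} [Field K] {ι κ : Type} [Fintype ι] (A : Matrix ι ι K) (B : Matrix κ κ K) : Prop :=
  ∃ P : Matrix ι κ K, Pᵀ * A * P = B

section rep
variable {K : Type} [Field K] {ι κ μ ν : Type} [Fintype ι] [Fintype κ] [Fintype μ] [Fintype ν]
  [DecidableEq ι] [DecidableEq κ] [DecidableEq μ] [DecidableEq ν]

theorem Rep.refl (A : Matrix ι ι K) : Rep A A := ⟨1, by simp⟩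

theorem Rep.trans {A : Matrix ι ι K} {B : Matrix κ κ K} {C : Matrix μ μ K}
    (h : Rep A B) (h' : Rep B C) : Rep A C := by
  obtain ⟨P, rfl⟩ := h
  obtain ⟨Q, rfl⟩ := h'
  exact ⟨P * Q, by simp [Matrix.mul_assoc]⟩

theorem Rep.sum {A : Matrix ι ι K} {B : Matrix κ κ K} {A' : Matrix μ μ K} {B' : Matrix ν ν K}
    (h : Rep A B) (h' : Rep A' B') :
    Rep (fromBlocks A 0 0 A') (fromBlocks B 0 0 B') := by
  obtain ⟨P, rfl⟩ := h
  obtain ⟨Q, rfl⟩ := h'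
  exact ⟨fromBlocks P 0 0 Q, by simp [Matrix.fromBlocks_transpose, Matrix.fromBlocks_multiply]⟩

theorem Rep.symm {A : Matrix ι ι K} {B : Matrix κ κ K}
    (h : Rep A B) (hc : Fintype.card ι = Fintype.card κ) (hB : B.det ≠ 0) : Rep B A := by
  obtain ⟨P, hP⟩ := h
  have h1 : (B⁻¹ * (Pᵀ * A)) * P = 1 := by
    rw [Matrix.mul_assoc, hP]
    exact Matrix.nonsing_inv_mul _ (isUnit_iff_ne_zero.mpr hB)
  have h2 : P * (B⁻¹ * (Pᵀ * A)) = 1 := (Matrix.mul_eq_one_comm_of_card_eq _ _ _ hc).mpr h1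
  set P' := B⁻¹ * (Pᵀ * A) with hP'
  refine ⟨P', ?_⟩
  have h3 : P'ᵀ * Pᵀ = 1 := by rw [← Matrix.transpose_mul, h2, Matrix.transpose_one]
  calc P'ᵀ * B * P' = (P'ᵀ * Pᵀ) * A * (P * P') := by rw [← hP]; simp only [Matrix.mul_assoc]
    _ = A := by rw [h2, h3]; simp

theorem Rep.map {K' : Type} [Field K'] (f : K →+* K') {A : Matrix ι ι K} {B : Matrix κ κ K}
    (h : Rep A B) : Rep (A.map f) (B.map f) := by
  obtain ⟨P, rfl⟩ := h
  exact ⟨P.map f, by simp [Matrix.map_mul, Matrix.transpose_map]⟩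

theorem rep_reindex (A : Matrix ι ι K) (e : κ ≃ ι) : Rep A (A.submatrix e e) := by
  refine ⟨(1 : Matrix ι ι K).submatrix id e, ?_⟩
  ext i j
  simp [Matrix.mul_apply, Matrix.one_apply]

/-- One dimensional Witt cancellation. -/
theorem Rep.cancel (h2 : (2 : K) ≠ 0) {u : K} {A : Matrix ι ι K} (hA : A.IsSymm) {B : Matrix κ κ K}
    (h : Rep (fromBlocks (diagonal fun _ : Unit => u) 0 0 A)
      (fromBlocks (diagonal fun _ : Unit => u) 0 0 B)) : Rep A B := by
  obtain ⟨P, hP⟩ := h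
  obtain ⟨x, y, z, W, rfl⟩ : ∃ x y z W, P = fromBlocks x y z W :=
    ⟨_, _, _, _, (Matrix.fromBlocks_toBlocks P).symm⟩
  rw [Matrix.fromBlocks_transpose, Matrix.fromBlocks_multiply, Matrix.fromBlocks_multiply,
    Matrix.fromBlocks_inj] at hP
  obtain ⟨e1, e2, e3, e4⟩ := hP
  simp only [Matrix.mul_zero, add_zero, zero_add] at e1 e2 e3 e4
  obtain ⟨x0, hx⟩ : ∃ x0 : K, x = x0 • (1 : Matrix Unit Unit K) :=
    ⟨x () (), by ext; simp⟩
  have hu : (diagonal fun _ : Unit => u) = u • (1 : Matrix Unit Unit K) := by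
    ext; simp
  rw [hu, hx] at e1
  rw [hu, hx] at e2 e3
  rw [hu] at e4
  simp only [Matrix.transpose_smul, Matrix.transpose_one, Matrix.smul_mul, Matrix.mul_smul,
    Matrix.one_mul, Matrix.mul_one] at e1 e2 e3 e4
  obtain ⟨c, hc⟩ : ∃ c : K, -1 + 2 * c * x0 + c ^ 2 * (1 - x0 ^ 2) = 0 := by
    by_cases hx1 : x0 + 1 = 0
    · have hx2 : x0 - 1 ≠ 0 := by
        intro h
        apply h2
        linear_combination hx1 - h
      exact ⟨(x0 - 1)⁻¹, by field_simp; ring⟩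
    · exact ⟨(x0 + 1)⁻¹, by field_simp; ring⟩
  refine ⟨W - c • (z * y), ?_⟩
  have f1 : zᵀ * A * z = (u * (1 - x0 ^ 2)) • (1 : Matrix Unit Unit K) := by
    rw [← sub_eq_zero] at e1 ⊢
    rw [← e1]
    module
  have f2 : zᵀ * A * W = -((u * x0) • y) := by
    rw [← sub_eq_zero] at e2 ⊢
    rw [← e2]
    module
  have f3 : Wᵀ * A * z = -((u * x0) • yᵀ) := by
    rw [← sub_eq_zero] at e3 ⊢
    rw [← e3]
    module
  have f4 : Wᵀ * A * W = B - u • (yᵀ * y) := by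
    rw [← e4]; module
  have : (W - c • (z * y))ᵀ * A * (W - c • (z * y)) =
      Wᵀ * A * W - c • ((Wᵀ * A * z) * y) - c • (yᵀ * (zᵀ * A * W))
        + (c ^ 2) • (yᵀ * (zᵀ * A * z) * y) := by
    simp only [Matrix.transpose_sub, Matrix.transpose_smul, Matrix.transpose_mul, Matrix.sub_mul,
      Matrix.mul_sub, Matrix.smul_mul, Matrix.mul_smul, Matrix.mul_assoc]
    module
  rw [this, f1, f2, f3, f4]
  simp only [Matrix.neg_mul, Matrix.mul_neg, Matrix.smul_mul, Matrix.mul_smul, Matrix.mul_one]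
  have : B = B + (u * (-1 + 2 * c * x0 + c ^ 2 * (1 - x0 ^ 2))) • (yᵀ * y) := by
    rw [hc]; simp
  conv_rhs => rw [this]
  module

theorem exists_equiv_of_map_eq {α : Type} (a : ι → α) (b : κ → α)
    (h : Finset.univ.val.map a = Finset.univ.val.map b) : ∃ e : κ ≃ ι, ∀ j, a (e j) = b j := by
  classical
  have hc : ∀ x, Nonempty ({j // b j = x} ≃ {i // a i = x}) := by
    intro x
    refine ⟨Fintype.equivOfCardEq ?_⟩
    have := congrArg (Multiset.count x) h
    rw [Multiset.count_map, Multiset.count_map] at this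
    rw [Fintype.card_subtype, Fintype.card_subtype]
    simp only [Finset.card, Finset.filter_val, eq_comm (b := x)]
    exact this.symm
  refine ⟨(Equiv.sigmaFiberEquiv b).symm.trans ((Equiv.sigmaCongrRight fun x => (hc x).some).trans
    (Equiv.sigmaFiberEquiv a)), fun j => ?_⟩
  simp [Equiv.sigmaFiberEquiv]
  exact ((hc (b j)).some ⟨j, rfl⟩).2

theorem rep_diag_of_map_eq (a : ι → K) (b : κ → K)
    (h : Finset.univ.val.map a = Finset.univ.val.map b) : Rep (diagonal a) (diagonal b) := by
  obtain ⟨e, he⟩ := exists_equiv_of_map_eq a b h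
  have := rep_reindex (diagonal a) e
  rwa [Matrix.submatrix_diagonal_equiv, show a ∘ e = b from funext he] at this

end rep

/-! ### Isometry of diagonal forms -/

def Iso {K : Type} [Field K] (s t : Multiset K) : Prop :=
  ∃ (n : ℕ) (a b : Fin n → K), Finset.univ.val.map a = s ∧ Finset.univ.val.map b = t ∧
    Rep (diagonal a) (diagonal b)

section iso
variable {K : Type} [Field K] {ι κ : Type} [Fintype ι] [Fintype κ] [DecidableEq ι] [DecidableEq κ]

theorem iso_of (a : ι → K) (b : κ → K) (hc : Fintype.card ι = Fintype.card κ)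
    (h : Rep (diagonal a) (diagonal b)) :
    Iso (Finset.univ.val.map a) (Finset.univ.val.map b) := by
  let e := (Fintype.equivFin ι).symm
  let e' : Fin (Fintype.card ι) ≃ κ := Fintype.equivOfCardEq (by simpa using hc)
  have q1 : Finset.univ.val.map (a ∘ e) = Finset.univ.val.map a := by
    rw [← Multiset.map_map]; congr 1
    exact congrArg Finset.val (Finset.map_univ_equiv e)
  have q2 : Finset.univ.val.map (b ∘ e') = Finset.univ.val.map b := by
    rw [← Multiset.map_map]; congr 1
    exact congrArg Finset.val (Finset.map_univ_equiv e')
  exact ⟨_, a ∘ e, b ∘ e', q1, q2,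
    ((rep_diag_of_map_eq _ _ q1).trans h).trans (rep_diag_of_map_eq _ _ q2.symm)⟩

theorem Iso.rep {a : ι → K} {b : κ → K}
    (h : Iso (Finset.univ.val.map a) (Finset.univ.val.map b)) :
    Rep (diagonal a) (diagonal b) := by
  obtain ⟨n, a', b', h1, h2, h3⟩ := h
  exact ((rep_diag_of_map_eq _ _ h1.symm).trans h3).trans (rep_diag_of_map_eq _ _ h2)

theorem exists_fin (s : Multiset K) : ∃ (n : ℕ) (a : Fin n → K), Finset.univ.val.map a = s := by
  obtain ⟨l, rfl⟩ := Quot.exists_rep s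
  exact ⟨l.length, l.get, by simp⟩

theorem Iso.refl (s : Multiset K) : Iso s s := by
  obtain ⟨n, a, rfl⟩ := exists_fin s
  exact ⟨n, a, a, rfl, rfl, Rep.refl _⟩

theorem Iso.card {s t : Multiset K} (h : Iso s t) : Multiset.card s = Multiset.card t := by
  obtain ⟨n, a, b, rfl, rfl, -⟩ := h
  simp

theorem Iso.trans {s t u : Multiset K} (h : Iso s t) (h' : Iso t u) : Iso s u := by
  have := h.card
  have := h'.card
  obtain ⟨n, a, rfl⟩ := exists_fin s
  obtain ⟨n', b, rfl⟩ := exists_fin t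
  obtain ⟨n'', c, rfl⟩ := exists_fin u
  refine iso_of _ _ (by simp_all) (h.rep.trans h'.rep)

theorem Iso.symm {s t : Multiset K} (h : Iso s t) (ht : (0 : K) ∉ t) : Iso t s := by
  obtain ⟨n, a, b, rfl, rfl, h⟩ := h
  refine ⟨n, b, a, rfl, rfl, h.symm rfl ?_⟩
  rw [Matrix.det_diagonal, Finset.prod_ne_zero_iff]
  intro i _ h0
  exact ht (by rw [← h0]; exact Multiset.mem_map_of_mem _ (Finset.mem_univ i))

theorem map_sum_elim (a : ι → K) (b : κ → K) : Finset.univ.val.map (Sum.elim a b) =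
    Finset.univ.val.map a + Finset.univ.val.map b := by
  rw [← Finset.univ_disjSum_univ, Finset.val_disjSum, Multiset.disjSum, Multiset.map_add,
    Multiset.map_map, Multiset.map_map]
  rfl

theorem Iso.add {s t s' t' : Multiset K} (h : Iso s t) (h' : Iso s' t') : Iso (s + s') (t + t') := by
  obtain ⟨n, a, b, rfl, rfl, h⟩ := h
  obtain ⟨n', a', b', rfl, rfl, h'⟩ := h'
  rw [← map_sum_elim, ← map_sum_elim]
  refine iso_of _ _ rfl ?_
  have := h.sum h'
  rwa [Matrix.fromBlocks_diagonal, Matrix.fromBlocks_diagonal] at this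

theorem Iso.cancel_one (h2 : (2 : K) ≠ 0) {u : K} {s t : Multiset K} (h : Iso (u ::ₘ s) (u ::ₘ t)) :
    Iso s t := by
  have hc := h.card
  obtain ⟨n, a, rfl⟩ := exists_fin s
  obtain ⟨n', b, rfl⟩ := exists_fin t
  have e : ∀ (n : ℕ) (a : Fin n → K), u ::ₘ Finset.univ.val.map a =
      Finset.univ.val.map (Sum.elim (fun _ : Unit => u) a) := by
    intro n a; rw [map_sum_elim]; simp
  rw [e, e] at h
  have := h.rep
  rw [← Matrix.fromBlocks_diagonal, ← Matrix.fromBlocks_diagonal] at this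
  exact iso_of _ _ (by simpa using hc) (this.cancel h2 (Matrix.isSymm_diagonal _))

theorem Iso.cancel (h2 : (2 : K) ≠ 0) {u s t : Multiset K} (h : Iso (u + s) (u + t)) :
    Iso s t := by
  induction u using Multiset.induction with
  | empty => simpa using h
  | cons a u ih =>
    rw [Multiset.cons_add, Multiset.cons_add] at h
    exact ih (h.cancel_one h2)

theorem Iso.map {K' : Type} [Field K'] (f : K →+* K') {s t : Multiset K} (h : Iso s t) :
    Iso (s.map f) (t.map f) := by
  obtain ⟨n, a, b, rfl, rfl, h⟩ := h
  rw [Multiset.map_map, Multiset.map_map]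
  refine iso_of _ _ rfl ?_
  have := h.map f
  rwa [Matrix.diagonal_map (map_zero f), Matrix.diagonal_map (map_zero f)] at this

theorem iso_sq (a : K) {c : K} : Iso {a} {a * c ^ 2} := by
  have : Iso (Finset.univ.val.map fun _ : Unit => a) (Finset.univ.val.map fun _ : Unit => a * c ^ 2) := by
    refine iso_of _ _ rfl ⟨diagonal fun _ => c, ?_⟩
    simp only [Matrix.diagonal_transpose, Matrix.diagonal_mul_diagonal]
    congr 1; ext; ring
  simpa using this

theorem iso_add (a b : K) : Iso {a, b} {a + b, a * b * (a + b)} := by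
  have e : ∀ a b : K, ({a, b} : Multiset K) =
      Finset.univ.val.map ![a, b] := by
    intro a b; simp [Fin.univ_val_map]; rfl
  rw [e, e]
  refine iso_of _ _ rfl ⟨!![1, -b; 1, a], ?_⟩
  ext i j
  fin_cases i <;> fin_cases j <;> simp [Matrix.mul_apply, Fin.sum_univ_two] <;> ring

theorem iso_hyp (h2 : (2 : K) ≠ 0) (a : K) : Iso ({1, -1} : Multiset K) {a, -a} := by
  have e : ∀ a b : K, ({a, b} : Multiset K) =
      Finset.univ.val.map ![a, b] := by
    intro a b; simp [Fin.univ_val_map]; rfl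
  rw [e, e]
  refine iso_of _ _ rfl ⟨!![(a + 1) / 2, (a - 1) / 2; (a - 1) / 2, (a + 1) / 2], ?_⟩
  ext i j
  fin_cases i <;> fin_cases j <;> simp [Matrix.mul_apply, Fin.sum_univ_two] <;> field_simp <;> ring

end iso
end HasseW
namespace HasseW

open Matrix

set_option linter.unusedSectionVars false

/-! ### The Witt group -/

open Classical in
noncomputable def nz {K : Type} [Field K] (s : Multiset K) : Multiset K := s.filter (· ≠ 0)

def hyp (K : Type) [Field K] : Multiset K := {1, -1}

section witt
variable {K : Type} [Field K]

theorem nz_add (s t : Multiset K) : nz (s + t) = nz s + nz t := by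
  classical
  simp [nz, Multiset.filter_add]

theorem zero_notMem_nz (s : Multiset K) : (0 : K) ∉ nz s := by
  classical
  simp [nz]

theorem nz_eq {s : Multiset K} (h : (0 : K) ∉ s) : nz s = s := by
  classical
  rw [nz, Multiset.filter_eq_self]
  rintro a ha rfl
  exact h ha

theorem zero_notMem_hyp (n : ℕ) : (0 : K) ∉ n • hyp K := by
  intro h
  have := Multiset.mem_of_mem_nsmul h
  simp [hyp] at this

theorem zero_notMem_add {s t : Multiset K} (h : (0 : K) ∉ s) (h' : (0 : K) ∉ t) : (0 : K) ∉ s + t := by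
  rw [Multiset.mem_add]; tauto

def wittCon (K : Type) [Field K] : AddCon (Multiset K) where
  r s t := ∃ m n : ℕ, Iso (nz s + m • hyp K) (nz t + n • hyp K)
  iseqv := by
    refine ⟨fun s => ⟨0, 0, Iso.refl _⟩, ?_, ?_⟩
    · rintro s t ⟨m, n, h⟩
      exact ⟨n, m, h.symm (zero_notMem_add (zero_notMem_nz _) (zero_notMem_hyp _))⟩
    · rintro s t u ⟨m, n, h⟩ ⟨m', n', h'⟩
      refine ⟨m + m', n' + n, ?_⟩
      have a1 := h.add (Iso.refl (m' • hyp K))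
      have a2 := h'.add (Iso.refl (n • hyp K))
      rw [add_nsmul, add_nsmul, ← add_assoc, ← add_assoc]
      refine a1.trans ?_
      rwa [add_right_comm]
  add' := by
    rintro s t s' t' ⟨m, n, h⟩ ⟨m', n', h'⟩
    refine ⟨m + m', n + n', ?_⟩
    rw [nz_add, nz_add, add_nsmul, add_nsmul, add_add_add_comm, add_add_add_comm (nz t)]
    exact h.add h'

theorem wittCon_iff {s t : Multiset K} :
    wittCon K s t ↔ ∃ m n : ℕ, Iso (nz s + m • hyp K) (nz t + n • hyp K) := Iff.rfl

theorem wittCon_of_iso {s t : Multiset K} (h : Iso (nz s) (nz t)) : wittCon K s t :=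
  ⟨0, 0, by simpa using h⟩

variable [NeZero (2 : K)]

theorem wittCon_neg (s : Multiset K) : wittCon K (s.map Neg.neg + s) 0 := by
  induction s using Multiset.induction with
  | empty => exact (wittCon K).refl _
  | cons a s ih =>
    have e : (a ::ₘ s).map Neg.neg + a ::ₘ s = {a, -a} + (s.map Neg.neg + s) := by
      simp only [Multiset.map_cons, Multiset.insert_eq_cons, Multiset.cons_add,
        Multiset.singleton_add, Multiset.add_cons]
    rw [e]
    have : wittCon K {a, -a} 0 := by
      by_cases ha : a = 0
      · subst ha
        refine wittCon_of_iso ?_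
        have : nz ({0, -0} : Multiset K) = nz 0 := by
          classical
          simp [nz, Multiset.filter_cons, Multiset.filter_singleton]
        rw [this]; exact Iso.refl _
      · refine ⟨0, 1, ?_⟩
        rw [nz_eq (by simp [eq_comm, ha])]
        have h := iso_hyp (two_ne_zero : (2 : K) ≠ 0) a
        have := h.symm (by simp [eq_comm, ha])
        simpa [nz, hyp] using this
    simpa using (wittCon K).add this ih

def W (K : Type) [Field K] : Type := (wittCon K).Quotient

instance : AddCommMonoid (W K) := inferInstanceAs (AddCommMonoid (wittCon K).Quotient)

def mk (s : Multiset K) : W K := ((s : Multiset K) : (wittCon K).Quotient)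

theorem mk_eq {s t : Multiset K} : mk s = mk t ↔ wittCon K s t := AddCon.eq _

theorem mk_surj (x : W K) : ∃ s, mk s = x := by
  obtain ⟨s, hs⟩ := AddCon.mk'_surjective (c := wittCon K) x
  exact ⟨s, hs⟩

theorem mk_add (s t : Multiset K) : mk (s + t) = mk s + mk t := rfl
theorem mk_zero : mk (0 : Multiset K) = 0 := rfl

theorem exists_neg (x : W K) : ∃ y, y + x = 0 := by
  obtain ⟨s, rfl⟩ := mk_surj x
  exact ⟨mk (s.map Neg.neg), by rw [← mk_add, ← mk_zero, mk_eq]; exact wittCon_neg s⟩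

noncomputable instance : Neg (W K) := ⟨fun x => (exists_neg x).choose⟩

noncomputable instance : AddCommGroup (W K) :=
  { (inferInstance : AddCommMonoid (W K)) with
    neg_add_cancel := fun x => (exists_neg x).choose_spec
    zsmul := zsmulRec }

def w (a : K) : W K := mk {a}

theorem mk_eq_sum (s : Multiset K) : mk s = (s.map w).sum := by
  induction s using Multiset.induction with
  | empty => simp [mk_zero]
  | cons a s ih => rw [← Multiset.singleton_add, mk_add, ih]; simp [w]

theorem w_zero : w (0 : K) = 0 := by
  rw [w, ← mk_zero, mk_eq]
  refine wittCon_of_iso ?_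
  have : nz ({0} : Multiset K) = nz 0 := by
    classical
    simp [nz, Multiset.filter_singleton]
  rw [this]; exact Iso.refl _

theorem w_neg (a : K) : w (-a) = - w a := by
  rw [eq_neg_iff_add_eq_zero, w, w, ← mk_add, ← mk_zero, mk_eq]
  simpa using wittCon_neg {a}

theorem w_sq (a : K) {c : K} (hc : c ≠ 0) : w (a * c ^ 2) = w a := by
  by_cases ha : a = 0
  · simp [ha]
  · rw [eq_comm, w, w, mk_eq]
    refine wittCon_of_iso ?_
    rw [nz_eq, nz_eq]
    · exact iso_sq a
    · simp [@eq_comm _ (0 : K), ha, hc]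
    · simp [eq_comm, ha]

theorem w_add (a b : K) : w a + w b = w (a + b) + w (a * b * (a + b)) := by
  by_cases ha : a = 0
  · simp [ha, w_zero]
  by_cases hb : b = 0
  · simp [hb, w_zero]
  by_cases hab : a + b = 0
  · rw [hab, mul_zero, w_zero, eq_neg_of_add_eq_zero_left hab, w_neg]; simp
  · have e : ∀ a b : K, w a + w b = mk {a, b} := fun a b => rfl
    rw [e, e, mk_eq]
    refine wittCon_of_iso ?_
    rw [nz_eq, nz_eq]
    · exact iso_add a b
    · simp [@eq_comm _ (0 : K), ha, hb, hab]
    · simp [@eq_comm _ (0 : K), ha, hb]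

theorem nz_map {K' : Type} [Field K'] (f : K →+* K') (s : Multiset K) :
    nz (s.map f) = (nz s).map f := by
  classical
  simp only [nz, Multiset.filter_map]
  congr 1
  refine Multiset.filter_congr ?_
  simp

theorem hyp_map {K' : Type} [Field K'] (f : K →+* K') : (hyp K).map f = hyp K' := by
  simp [hyp]

theorem wittCon_map {K' : Type} [Field K'] (f : K →+* K') {s t : Multiset K}
    (h : wittCon K s t) : wittCon K' (s.map f) (t.map f) := by
  obtain ⟨m, n, h⟩ := h
  refine ⟨m, n, ?_⟩
  have := h.map f
  simpa [Multiset.map_add, Multiset.map_nsmul, hyp_map, nz_map] using this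

theorem iso_of_wittCon {s t : Multiset K} (hs : (0 : K) ∉ s) (ht : (0 : K) ∉ t)
    (hc : Multiset.card s = Multiset.card t) (h : wittCon K s t) : Iso s t := by
  obtain ⟨m, n, h⟩ := h
  rw [nz_eq hs, nz_eq ht] at h
  have := h.card
  have hmn : m = n := by simpa [hc, hyp] using this
  subst hmn
  rw [add_comm s, add_comm t] at h
  exact h.cancel two_ne_zero

theorem iso_hyp_of_wittCon {s : Multiset K} (hs : (0 : K) ∉ s) (h : wittCon K s 0) :
    ∃ k : ℕ, Iso s (k • hyp K) := by
  obtain ⟨m, n, h⟩ := h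
  rw [nz_eq hs, nz_eq (by simp)] at h
  have := h.card
  have hmn : m ≤ n := by
    simp [hyp] at this; omega
  obtain ⟨k, rfl⟩ := Nat.exists_eq_add_of_le hmn
  refine ⟨k, ?_⟩
  rw [add_comm s, zero_add, add_nsmul] at h
  exact h.cancel two_ne_zero

theorem lagrangian {ι : Type} [Fintype ι] [DecidableEq ι] (a : ι → K) (ha : ∀ i, a i ≠ 0)
    (h : mk (Finset.univ.val.map a) = 0) :
    ∃ X : Submodule K (ι → K), (∀ x ∈ X, ∀ y ∈ X, ∑ i, a i * x i * y i = 0) ∧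
      2 * Module.finrank K X = Fintype.card ι := by
  rw [← mk_zero, mk_eq] at h
  obtain ⟨k, hk⟩ := iso_hyp_of_wittCon (by simp [ha]) h
  have hcard := hk.card
  have e : k • hyp K = Finset.univ.val.map (Sum.elim (fun _ : Fin k => (1 : K)) (fun _ : Fin k => -1)) := by
    rw [map_sum_elim]
    simp [hyp, Multiset.insert_eq_cons, ← Multiset.singleton_add, nsmul_add, Multiset.nsmul_singleton]
  rw [e] at hk
  obtain ⟨P, hP⟩ := hk.rep
  have hinj : Function.Injective P.mulVecLin := by
    rw [← LinearMap.ker_eq_bot, LinearMap.ker_eq_bot']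
    intro v hv
    have : diagonal (Sum.elim (fun _ : Fin k => (1 : K)) (fun _ : Fin k => -1)) *ᵥ v = 0 := by
      rw [← hP, ← Matrix.mulVec_mulVec]
      simp only [Matrix.mulVecLin_apply] at hv
      rw [hv, Matrix.mulVec_zero]
    ext i
    have := congrFun this i
    rw [Matrix.mulVec_diagonal] at this
    rcases i with i | i <;> simpa using this
  let D : (Fin k → K) →ₗ[K] (Fin k ⊕ Fin k → K) :=
    { toFun := fun c => Sum.elim c c
      map_add' := by intro x y; ext i; rcases i <;> rfl
      map_smul' := by intro x y; ext i; rcases i <;> rfl }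
  have hD : Function.Injective D := by
    intro x y hxy
    ext i
    exact congrFun hxy (Sum.inl i)
  refine ⟨LinearMap.range (P.mulVecLin ∘ₗ D), ?_, ?_⟩
  · rintro _ ⟨c, rfl⟩ _ ⟨d, rfl⟩
    have : ∀ x y : ι → K, ∑ i, a i * x i * y i = x ⬝ᵥ (diagonal a *ᵥ y) := by
      intro x y
      simp only [dotProduct, Matrix.mulVec_diagonal]
      exact Finset.sum_congr rfl fun i _ => by ring
    rw [this]
    simp only [LinearMap.comp_apply, Matrix.mulVecLin_apply]
    rw [Matrix.mulVec_mulVec, Matrix.dotProduct_mulVec, ← Matrix.vecMul_transpose,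
      Matrix.vecMul_vecMul, ← Matrix.mul_assoc, hP, ← Matrix.dotProduct_mulVec]
    simp [dotProduct, Matrix.mulVec_diagonal, D]
  · rw [LinearMap.finrank_range_of_inj (f := P.mulVecLin ∘ₗ D) (by
      rw [LinearMap.coe_comp]; exact hinj.comp hD)]
    simp [hyp] at hcard
    simp; omega

end witt
end HasseW
namespace HasseW

open Matrix

set_option linter.unusedSectionVars false

/-! ### The local argument at `p` -/

theorem isotropic_finrank {F : Type} [Field F] {ι : Type} [Fintype ι] [DecidableEq ι] (u : ι → F)
    (hu : ∀ i, u i ≠ 0) (Y : Submodule F (ι → F))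
    (hY : ∀ x ∈ Y, ∀ y ∈ Y, ∑ i, u i * x i * y i = 0) :
    2 * Module.finrank F Y ≤ Fintype.card ι := by
  have hn : (Matrix.toBilin' (diagonal u)).Nondegenerate := by
    apply Matrix.Nondegenerate.toBilin'
    apply Matrix.nondegenerate_of_det_ne_zero
    rw [Matrix.det_diagonal, Finset.prod_ne_zero_iff]
    exact fun i _ => hu i
  have h1 := LinearMap.BilinForm.finrank_orthogonal hn Y
  have h2 : Y ≤ LinearMap.BilinForm.orthogonal (Matrix.toBilin' (diagonal u)) Y := by
    intro x hx y hy
    rw [Matrix.toBilin'_apply']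
    simp only [dotProduct, Matrix.mulVec_diagonal]
    rw [← hY y hy x hx]
    exact Finset.sum_congr rfl fun i _ => by ring
  have h3 := Submodule.finrank_mono h2
  have h4 := Submodule.finrank_le Y
  rw [Module.finrank_fintype_fun_eq_card] at h1 h4
  omega

section padic
variable {p : ℕ} [hp : Fact p.Prime] {ι κ : Type} [Fintype ι] [DecidableEq ι]
  [Fintype κ] [DecidableEq κ]

theorem toZMod_eq_zero {x : ℤ_[p]} (h : PadicInt.toZMod x = 0) : ∃ y, x = p * y := by
  have : x ∈ RingHom.ker (PadicInt.toZMod (p := p)) := h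
  rw [PadicInt.ker_toZMod, PadicInt.maximalIdeal_eq_span_p, Ideal.mem_span_singleton] at this
  exact this

theorem toZMod_surj (c : ZMod p) : ∃ x : ℤ_[p], PadicInt.toZMod x = c :=
  ⟨(c.val : ℤ_[p]), by simp⟩

theorem reduction (X : Submodule ℚ_[p] (ι → ℚ_[p])) : ∃ (m : ℕ) (b : Fin m → ι → ℤ_[p]),
    Module.finrank ℚ_[p] X ≤ m ∧ (∀ i, (fun j => (b i j : ℚ_[p])) ∈ X) ∧
    LinearIndependent (ZMod p) (fun i j => PadicInt.toZMod (b i j)) := by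
  let N : Submodule ℤ_[p] (ι → ℤ_[p]) :=
    { carrier := {x | (fun j => (x j : ℚ_[p])) ∈ X}
      add_mem' := by
        intro x y hx hy
        have := X.add_mem hx hy
        simp only [Set.mem_ofPred_eq]
        convert this using 1
        ext j; simp
      zero_mem' := by
        simp only [Set.mem_ofPred_eq]
        convert X.zero_mem using 1
        ext j; simp
      smul_mem' := by
        intro c x hx
        have := X.smul_mem (c : ℚ_[p]) hx
        simp only [Set.mem_ofPred_eq]
        convert this using 1
        ext j; simp }
  have hN : ∀ x : ι → ℤ_[p], x ∈ N ↔ (fun j => (x j : ℚ_[p])) ∈ X := fun x => Iff.rfl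
  obtain ⟨m, B⟩ := Submodule.basisOfPid (Pi.basisFun ℤ_[p] ι) N
  have hp0 : (p : ℚ_[p]) ≠ 0 := by exact_mod_cast hp.out.ne_zero
  refine ⟨m, fun i => (B i : ι → ℤ_[p]), ?_, fun i => (hN _).1 (B i).2, ?_⟩
  · -- span
    let c : Fin m → (ι → ℚ_[p]) := fun i j => ((B i : ι → ℤ_[p]) j : ℚ_[p])
    have hsp : X ≤ Submodule.span ℚ_[p] (Set.range c) := by
      intro x hx
      obtain ⟨k, hk⟩ : ∃ k : ℕ, ∀ j, ‖(p : ℚ_[p]) ^ k * x j‖ ≤ 1 := by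
        have : ∀ j, ∃ k : ℕ, ∀ k' ≥ k, ‖(p : ℚ_[p]) ^ k' * x j‖ ≤ 1 := by
          intro j
          have h1 : Filter.Tendsto (fun k : ℕ => ‖(p : ℚ_[p]) ^ k * x j‖) Filter.atTop (nhds 0) := by
            have : Filter.Tendsto (fun k : ℕ => ‖(p : ℚ_[p])‖ ^ k * ‖x j‖) Filter.atTop (nhds (0 * ‖x j‖)) :=
              (tendsto_pow_atTop_nhds_zero_of_lt_one (norm_nonneg _) Padic.norm_p_lt_one).mul_const _
            simpa using this
          exact Filter.eventually_atTop.1 (h1.eventually_le_const one_pos)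
        choose k hk using this
        exact ⟨Finset.univ.sup k, fun j => hk j _ (Finset.le_sup (Finset.mem_univ j))⟩
      let y : ι → ℤ_[p] := fun j => ⟨(p : ℚ_[p]) ^ k * x j, hk j⟩
      have hy : (fun j => (y j : ℚ_[p])) = (p : ℚ_[p]) ^ k • x := by ext j; simp [y]
      have hyN : y ∈ N := by rw [hN, hy]; exact X.smul_mem _ hx
      have hrep := congrArg Subtype.val (B.sum_repr ⟨y, hyN⟩)
      have : (p : ℚ_[p]) ^ k • x ∈ Submodule.span ℚ_[p] (Set.range c) := by
        rw [← hy]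
        have : (fun j => (y j : ℚ_[p])) = ∑ i, ((B.repr ⟨y, hyN⟩ i : ℤ_[p]) : ℚ_[p]) • c i := by
          ext j
          have := congrFun hrep j
          simp only [Submodule.coe_sum, Submodule.coe_smul, Finset.sum_apply, Pi.smul_apply,
            smul_eq_mul] at this
          have h2 := congrArg (PadicInt.Coe.ringHom (p := p)) this
          rw [map_sum] at h2
          simp only [map_mul] at h2
          refine h2.symm.trans ?_
          simp only [Finset.sum_apply, Pi.smul_apply, smul_eq_mul]
          rfl
        rw [this]
        exact Submodule.sum_mem _ fun i _ => Submodule.smul_mem _ _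
          (Submodule.subset_span ⟨i, rfl⟩)
      have := Submodule.smul_mem _ (((p : ℚ_[p]) ^ k)⁻¹) this
      rwa [inv_smul_smul₀ (pow_ne_zero _ hp0)] at this
    refine (Submodule.finrank_mono hsp).trans ?_
    exact (finrank_range_le_card c).trans (by simp)
  · rw [Fintype.linearIndependent_iff]
    intro g hg i
    choose l hl using fun i => toZMod_surj (g i)
    have h1 : ∀ j, ∃ y, (∑ i, l i • (B i : ι → ℤ_[p])) j = p * y := by
      intro j
      apply toZMod_eq_zero
      have := congrFun hg j
      simp at this
      simp [hl, this]
    choose y hy using h1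
    have hyN : y ∈ N := by
      rw [hN]
      have h2 : (∑ i, l i • (B i : ι → ℤ_[p])) ∈ N :=
        Submodule.sum_mem _ fun i _ => Submodule.smul_mem _ _ (B i).2
      rw [hN] at h2
      have := X.smul_mem ((p : ℚ_[p])⁻¹) h2
      convert this using 1
      ext j
      rw [Pi.smul_apply, hy j]
      simp [hp0]
    have h3 : ∑ i, l i • B i = (p : ℤ_[p]) • (⟨y, hyN⟩ : N) := by
      apply Subtype.ext
      ext j
      have := hy j
      simp at this
      simp [this]
    have h4 := congrFun (B.repr_sum_self l) i
    rw [h3, map_smul, Finsupp.smul_apply, smul_eq_mul] at h4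
    rw [← hl i, ← h4]
    simp

theorem local_isotropic [Nonempty κ] (u : ι → ℤ) (v : κ → ℤ) (hu : ∀ i, ¬ (p : ℤ) ∣ u i)
    (X : Submodule ℚ_[p] (ι ⊕ κ → ℚ_[p]))
    (hX : ∀ x ∈ X, ∀ y ∈ X, ∑ i, Sum.elim (fun i => (u i : ℚ_[p])) (fun j => (p : ℚ_[p]) * (v j : ℚ_[p])) i
      * x i * y i = 0)
    (hd : 2 * Module.finrank ℚ_[p] X = Fintype.card (ι ⊕ κ)) :
    ∃ y : κ → ZMod p, y ≠ 0 ∧ ∑ j, (v j : ZMod p) * y j ^ 2 = 0 := by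
  obtain ⟨m, b, hm, hbX, hli⟩ := reduction X
  have hp0 : (p : ℤ_[p]) ≠ 0 := by exact_mod_cast hp.out.ne_zero
  have hint : ∀ x y : ι ⊕ κ → ℤ_[p], (fun j => (x j : ℚ_[p])) ∈ X → (fun j => (y j : ℚ_[p])) ∈ X →
      ∑ i, (u i : ℤ_[p]) * x (Sum.inl i) * y (Sum.inl i) +
        p * ∑ j, (v j : ℤ_[p]) * x (Sum.inr j) * y (Sum.inr j) = 0 := by
    intro x y hx hy
    have := hX _ hx _ hy
    rw [Fintype.sum_sum_type] at this
    simp only [Sum.elim_inl, Sum.elim_inr] at this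
    have h2 : PadicInt.Coe.ringHom (∑ i, (u i : ℤ_[p]) * x (Sum.inl i) * y (Sum.inl i) +
        p * ∑ j, (v j : ℤ_[p]) * x (Sum.inr j) * y (Sum.inr j) : ℤ_[p]) = 0 := by
      rw [← this]
      rw [map_add, map_mul, map_sum, map_sum, Finset.mul_sum]
      simp only [map_mul, map_intCast, map_natCast]
      congr 1
      exact Finset.sum_congr rfl fun i _ => by rw [← mul_assoc, ← mul_assoc]; rfl
    exact Subtype.ext h2
  have hlin : ∀ l : Fin m → ℤ_[p], (fun j => ((∑ i, l i • b i) j : ℚ_[p])) ∈ X := by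
    intro l
    have : (fun j => ((∑ i, l i • b i) j : ℚ_[p])) = ∑ i, (l i : ℚ_[p]) • (fun j => (b i j : ℚ_[p])) := by
      ext j; simp
    rw [this]
    exact Submodule.sum_mem _ fun i _ => Submodule.smul_mem _ _ (hbX i)
  -- the map from coefficients to the first coordinates
  let T : (Fin m → ZMod p) →ₗ[ZMod p] (ι → ZMod p) :=
    (LinearMap.funLeft (ZMod p) (ZMod p) Sum.inl) ∘ₗ
      (Fintype.linearCombination (ZMod p) (fun i j => PadicInt.toZMod (b i j)))
  have hT : ∀ l : Fin m → ℤ_[p], ∀ i, T (fun k => PadicInt.toZMod (l k)) i =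
      PadicInt.toZMod ((∑ i, l i • b i) (Sum.inl i)) := by
    intro l i
    simp [T, Fintype.linearCombination_apply, LinearMap.funLeft_apply]
  have hiso : 2 * Module.finrank (ZMod p) (LinearMap.range T) ≤ Fintype.card ι := by
    refine isotropic_finrank (fun i => (u i : ZMod p)) ?_ _ ?_
    · intro i h
      exact hu i ((ZMod.intCast_zmod_eq_zero_iff_dvd _ _).1 h)
    · rintro _ ⟨c, rfl⟩ _ ⟨d, rfl⟩
      choose l hl using fun i => toZMod_surj (c i)
      choose l' hl' using fun i => toZMod_surj (d i)
      obtain rfl : c = fun k => PadicInt.toZMod (l k) := funext fun k => (hl k).symm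
      obtain rfl : d = fun k => PadicInt.toZMod (l' k) := funext fun k => (hl' k).symm
      have := congrArg PadicInt.toZMod (hint _ _ (hlin l) (hlin l'))
      simp only [hT]
      rw [map_add, map_mul, map_natCast, CharP.cast_eq_zero, zero_mul, add_zero, map_zero] at this
      rw [← this]
      simp
  have hrn := LinearMap.finrank_range_add_finrank_ker T
  rw [Module.finrank_fintype_fun_eq_card, Fintype.card_fin] at hrn
  rw [Fintype.card_sum] at hd
  have hκ : 0 < Fintype.card κ := Fintype.card_pos
  have hker : 0 < Module.finrank (ZMod p) (LinearMap.ker T) := by omega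
  obtain ⟨⟨c, hcT⟩, hc0⟩ := Module.finrank_pos_iff_exists_ne_zero.1 hker
  have hc : c ≠ 0 := fun h => hc0 (Subtype.ext h)
  choose l hl using fun i => toZMod_surj (c i)
  obtain rfl : c = fun k => PadicInt.toZMod (l k) := funext fun k => (hl k).symm
  set x := ∑ i, l i • b i with hx
  refine ⟨fun j => PadicInt.toZMod (x (Sum.inr j)), ?_, ?_⟩
  · intro h0
    apply hc
    rw [Fintype.linearIndependent_iff] at hli
    ext k
    refine hli (fun k => PadicInt.toZMod (l k)) ?_ k
    ext j
    rcases j with j | j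
    · have h1 := hT l j
      rw [LinearMap.mem_ker.1 hcT] at h1
      rw [Pi.zero_apply] at h1
      simp at h1
      simp [← h1]
    · have h1 := congrFun h0 j
      simp [hx] at h1
      simp [h1]
  · have h1 : ∀ i, ∃ y, x (Sum.inl i) = p * y := by
      intro i
      apply toZMod_eq_zero
      rw [← hT l i, LinearMap.mem_ker.1 hcT]; rfl
    choose y hy using h1
    have h2 := hint x x (hlin l) (hlin l)
    have h3 : (p : ℤ_[p]) * (p * ∑ i, (u i : ℤ_[p]) * y i * y i +
        ∑ j, (v j : ℤ_[p]) * x (Sum.inr j) * x (Sum.inr j)) = 0 := by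
      rw [← h2]
      simp only [hy]
      rw [mul_add, ← mul_assoc, Finset.mul_sum]
      congr 1
      exact Finset.sum_congr rfl fun i _ => by ring
    have h4 := (mul_eq_zero.1 h3).resolve_left hp0
    have h5 := congrArg PadicInt.toZMod h4
    rw [map_add, map_mul, map_natCast, CharP.cast_eq_zero, zero_mul, zero_add, map_zero] at h5
    rw [← h5]
    simp [pow_two, mul_assoc]

end padic
end HasseW
namespace HasseW

set_option linter.unusedSectionVars false

/-! ### The global argument -/

def T (k : ℕ) : Submonoid ℤ := Submonoid.closure {n : ℤ | |n| < k}

noncomputable def wz (n : ℤ) : W ℚ := w (n : ℚ)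

noncomputable def S (k : ℕ) : AddSubgroup (W ℚ) := AddSubgroup.closure (wz '' (T k : Set ℤ))

theorem wz_zero : wz 0 = 0 := by simp [wz, w_zero]
theorem wz_neg (n : ℤ) : wz (-n) = - wz n := by simp [wz, w_neg]
theorem wz_add (a b : ℤ) : wz a + wz b = wz (a + b) + wz (a * b * (a + b)) := by
  simpa [wz] using w_add (a : ℚ) b
theorem wz_sq (a : ℤ) {c : ℤ} (hc : c ≠ 0) : wz (a * c ^ 2) = wz a := by
  simpa [wz] using w_sq (a : ℚ) (c := c) (by exact_mod_cast hc)

theorem mem_T {k : ℕ} {n : ℤ} (h : |n| < k) : n ∈ T k := Submonoid.subset_closure h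

theorem T_mono {k l : ℕ} (h : k ≤ l) : T k ≤ T l :=
  Submonoid.closure_mono fun n (hn : |n| < k) => show |n| < l by omega

theorem S_mono_of {k l : ℕ} (h : T k ≤ T l) : S k ≤ S l :=
  AddSubgroup.closure_mono (Set.image_mono h)

theorem wz_mem {k : ℕ} {n : ℤ} (h : n ∈ T k) : wz n ∈ S k :=
  AddSubgroup.subset_closure ⟨n, h, rfl⟩

theorem lemmaA2 {p : ℕ} {n₁ n₂ r l m : ℤ} (hp : 2 ≤ p) (h1 : |n₁| < p) (h2 : |n₂| < p) (hr : |r| < p)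
    (h : n₁ * n₂ = r + l * p) (hm : m ∈ T p) :
    wz (p * (n₁ * n₂) * m) - wz (p * r * m) ∈ S p := by
  by_cases hm0 : m = 0
  · simp [hm0]
  have hl : |l| < p := by
    have e : |l| * p ≤ (p - 1) * p := by
      calc |l| * p = |n₁ * n₂ - r| := by
            rw [h, add_sub_cancel_left, abs_mul]; simp
        _ ≤ |n₁ * n₂| + |r| := abs_sub _ _
        _ = |n₁| * |n₂| + |r| := by rw [abs_mul]
        _ ≤ (p - 1) * (p - 1) + (p - 1) := by
            have := mul_le_mul (show |n₁| ≤ p - 1 by omega) (show |n₂| ≤ p - 1 by omega)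
              (abs_nonneg _) (by omega)
            omega
        _ = _ := by ring
    have := le_of_mul_le_mul_right e (by omega)
    omega
  have hp0 : (p : ℤ) ≠ 0 := by omega
  have key := wz_add (p * r * m) (l * m * p ^ 2)
  rw [wz_sq _ hp0, show (p : ℤ) * r * m + l * m * p ^ 2 = p * (n₁ * n₂) * m by rw [h]; ring,
    show (p : ℤ) * r * m * (l * m * p ^ 2) * (p * (n₁ * n₂) * m) =
      (r * l * (n₁ * n₂) * m) * (p ^ 2 * m) ^ 2 by ring,
    wz_sq _ (by positivity)] at key
  have : wz (p * (n₁ * n₂) * m) - wz (p * r * m) = wz (l * m) - wz (r * l * (n₁ * n₂) * m) := by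
    rw [sub_eq_sub_iff_add_eq_add, ← key, add_comm]
  rw [this]
  exact sub_mem (wz_mem (mul_mem (mem_T hl) hm)) (wz_mem (mul_mem (mul_mem (mul_mem (mem_T hr)
    (mem_T hl)) (mul_mem (mem_T h1) (mem_T h2))) hm))

theorem lemmaA {p : ℕ} (hp : 2 ≤ p) {n : ℤ} (hn : n ∈ T p) : ∀ r m : ℤ, |r| < p →
    (p : ℤ) ∣ n - r → m ∈ T p → wz (p * n * m) - wz (p * r * m) ∈ S p := by
  induction hn using Submonoid.closure_induction_left with
  | one =>
    intro r m hr ⟨l, hl⟩ hm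
    have := lemmaA2 (n₁ := 1) (n₂ := 1) (l := l) hp (by simp; omega) (by simp; omega) hr
      (by linarith) hm
    simpa using this
  | mul_left x hx y hy ih =>
    intro r m hr ⟨l, hl⟩ hm
    have hx : |x| < p := hx
    have hr' : |y % p| < p := by
      rw [abs_of_nonneg (Int.emod_nonneg _ (by omega))]
      exact Int.emod_lt_of_pos _ (by omega)
    have e1 := ih (y % p) (x * m) hr' (Int.dvd_self_sub_emod) (mul_mem (mem_T hx) hm)
    have e2 := lemmaA2 (n₁ := x) (n₂ := y % p) (r := r) (l := l - x * (y / p)) hp hx hr' hr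
      (by
        have := Int.emod_add_mul_ediv y p
        linear_combination hl + x * this) hm
    have := add_mem e1 e2
    rw [show (p : ℤ) * y * (x * m) = p * (x * y) * m by ring,
      show (p : ℤ) * (y % p) * (x * m) = p * (x * (y % p)) * m by ring] at this
    simpa using this

section g
variable {p : ℕ} [hp : Fact p.Prime]

noncomputable def g (p : ℕ) (a : ZMod p) : W ℚ ⧸ S p := QuotientAddGroup.mk (wz (p * (a.val : ℤ)))

theorem abs_val_lt (a : ZMod p) : |(a.val : ℤ)| < p := by
  have := a.val_lt
  rw [Nat.abs_cast]; omega

theorem g_of {n : ℤ} (hn : n ∈ T p) : (QuotientAddGroup.mk (wz (p * n)) : W ℚ ⧸ S p) = g p n := by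
  have := lemmaA hp.out.two_le hn ((n : ZMod p).val) 1 (abs_val_lt _) (by
    rw [ZMod.val_intCast]; exact Int.dvd_self_sub_emod) (one_mem _)
  rw [g, eq_comm, QuotientAddGroup.eq]
  simpa [add_comm, sub_eq_add_neg] using this

theorem g_zero : g p 0 = 0 := by
  simp [g, wz_zero]

theorem g_add (a b : ZMod p) : g p a + g p b = g p (a + b) + g p (a * b * (a + b)) := by
  have hp0 : (p : ℤ) ≠ 0 := by exact_mod_cast hp.out.ne_zero
  by_cases hb : b = 0
  · simp [hb, g_zero]
  have ha' := abs_val_lt a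
  have hbv : 0 < b.val := Nat.pos_of_ne_zero (by simpa using hb)
  have hbl := b.val_lt
  have hal := a.val_lt
  have hB : |(b.val : ℤ) - p| < p := by rw [abs_lt]; omega
  have hAB : |(a.val : ℤ) + ((b.val : ℤ) - p)| < p := by rw [abs_lt]; omega
  have key := wz_add (p * (a.val : ℤ)) (p * ((b.val : ℤ) - p))
  rw [← mul_add, show (p : ℤ) * (a.val : ℤ) * (p * ((b.val : ℤ) - p)) *
      (p * ((a.val : ℤ) + ((b.val : ℤ) - p))) = (p * ((a.val : ℤ) * ((b.val : ℤ) - p) *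
      ((a.val : ℤ) + ((b.val : ℤ) - p)))) * p ^ 2 by ring, wz_sq _ hp0] at key
  have key2 := congrArg (QuotientAddGroup.mk (s := S p)) key
  rw [QuotientAddGroup.mk_add, QuotientAddGroup.mk_add, g_of (mem_T ha'), g_of (mem_T hB),
    g_of (mem_T hAB), g_of (mul_mem (mul_mem (mem_T ha') (mem_T hB)) (mem_T hAB))] at key2
  simpa using key2

theorem g_sq (a : ZMod p) {c : ZMod p} (hc : c ≠ 0) : g p (a * c ^ 2) = g p a := by
  have key := wz_sq (p * (a.val : ℤ)) (c := (c.val : ℤ))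
    (Int.natCast_ne_zero.2 ((ZMod.val_ne_zero c).2 hc))
  have key2 := congrArg (QuotientAddGroup.mk (s := S p)) key
  rw [mul_assoc, g_of (mem_T (abs_val_lt a)),
    g_of (mul_mem (mem_T (abs_val_lt a)) (pow_mem (mem_T (abs_val_lt c)) 2))] at key2
  simpa using key2

theorem g_neg (a : ZMod p) : g p (-a) = - g p a := by
  rw [eq_neg_iff_add_eq_zero, g_add]
  simp [g_zero]

end g

/-! ### Abstract reduction -/

theorem list_reduce {F G : Type} [Field F] [AddCommGroup G] (g : F → G) (g0 : g 0 = 0)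
    (ga : ∀ a b, g a + g b = g (a + b) + g (a * b * (a + b))) : ∀ (n : ℕ) (l : List F),
    l.length = n + 1 → l.sum = 0 →
    ∃ l' : List F, l'.length < l.length ∧ (l'.map g).sum = (l.map g).sum := by
  intro n
  induction n with
  | zero =>
    intro l hl hs
    obtain ⟨a, rfl⟩ := List.length_eq_one_iff.1 hl
    simp at hs
    exact ⟨[], by simp, by simp [hs, g0]⟩
  | succ n ih =>
    intro l hl hs
    match l, hl, hs with
    | a :: b :: t, hl, hs =>
      obtain ⟨l', h1, h2⟩ := ih ((a + b) :: t) (by simpa using hl) (by simpa [add_assoc] using hs)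
      refine ⟨(a * b * (a + b)) :: l', by simpa using h1, ?_⟩
      simp only [List.map_cons, List.sum_cons] at h2 ⊢
      rw [h2, ← add_assoc, ← add_assoc, ga a b, add_comm (g (a * b * (a + b)))]

theorem list_reduce' {F G : Type} [Field F] [AddCommGroup G] (g : F → G) (g0 : g 0 = 0)
    (ga : ∀ a b, g a + g b = g (a + b) + g (a * b * (a + b)))
    (gs : ∀ a c, c ≠ 0 → g (a * c ^ 2) = g a) (l : List F) (y : Fin l.length → F) (hy : y ≠ 0)
    (h : ∑ j, l.get j * y j ^ 2 = 0) :
    ∃ l' : List F, l'.length < l.length ∧ (l'.map g).sum = (l.map g).sum := by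
  classical
  let I := Finset.univ.filter fun j => y j ≠ 0
  let J := Finset.univ.filter fun j => ¬ y j ≠ 0
  have hI : 0 < I.card := by
    rw [Finset.card_pos]
    obtain ⟨j, hj⟩ := Function.ne_iff.1 hy
    exact ⟨j, by simpa [I] using hj⟩
  have hIJ : I.card + J.card = l.length := by
    have := Finset.card_filter_add_card_filter_not (s := (Finset.univ : Finset (Fin l.length))) (fun j => y j ≠ 0)
    simpa [I, J] using this
  obtain ⟨l', h1, h2⟩ := list_reduce g g0 ga (I.card - 1) (I.toList.map fun j => l.get j * y j ^ 2)
    (by simp; omega) (by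
      rw [Finset.sum_map_toList, ← h]
      refine Finset.sum_subset (Finset.subset_univ _) ?_
      intro j _ hj
      have : y j = 0 := by simpa [I] using hj
      simp [this])
  refine ⟨l' ++ J.toList.map l.get, ?_, ?_⟩
  · simp at h1 ⊢; omega
  · rw [List.map_append, List.sum_append, h2, List.map_map, List.map_map, Finset.sum_map_toList,
      Finset.sum_map_toList]
    have e : (l.map g).sum = ∑ j, g (l.get j) := by
      conv_lhs => rw [← List.ofFn_get l, List.map_ofFn, List.sum_ofFn]
      rfl
    rw [e, ← Finset.sum_filter_add_sum_filter_not Finset.univ (fun j => y j ≠ 0)]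
    congr 1
    refine Finset.sum_congr rfl fun j hj => ?_
    exact gs _ _ (by simpa using hj)

end HasseW
namespace HasseW

set_option linter.unusedSectionVars false

/-! ### Descent -/

def LocZero (K : Type) [Field K] [NeZero (2 : K)] [CharZero K] (x : W ℚ) : Prop :=
  ∀ s : Multiset ℚ, mk s = x → mk (s.map (Rat.castHom K)) = 0

theorem S_rep {k : ℕ} (hk : 2 ≤ k) {x : W ℚ} (hx : x ∈ S k) :
    ∃ s : Multiset ℤ, (∀ n ∈ s, n ∈ T k ∧ n ≠ 0) ∧ (s.map wz).sum = x := by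
  induction hx using AddSubgroup.closure_induction with
  | mem x hx =>
    obtain ⟨n, hn, rfl⟩ := hx
    by_cases h0 : n = 0
    · exact ⟨0, by simp, by simp [h0, wz_zero]⟩
    · exact ⟨{n}, by simpa using ⟨hn, h0⟩, by simp⟩
  | zero => exact ⟨0, by simp, by simp⟩
  | add x y hx hy ihx ihy =>
    obtain ⟨s, hs, rfl⟩ := ihx
    obtain ⟨t, ht, rfl⟩ := ihy
    refine ⟨s + t, ?_, by simp⟩
    intro n hn
    rcases Multiset.mem_add.1 hn with h | h
    exacts [hs n h, ht n h]
  | neg x hx ihx =>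
    obtain ⟨s, hs, rfl⟩ := ihx
    refine ⟨s.map Neg.neg, ?_, ?_⟩
    · intro n hn
      obtain ⟨m, hm, rfl⟩ := Multiset.mem_map.1 hn
      refine ⟨?_, neg_ne_zero.2 (hs m hm).2⟩
      rw [← neg_one_mul]
      exact mul_mem (mem_T (by simp; omega)) (hs m hm).1
    · rw [Multiset.map_map, ← Multiset.sum_map_neg]
      congr 1
      refine Multiset.map_congr rfl fun n _ => ?_
      simp [wz_neg]

section step
variable {p : ℕ} [hp : Fact p.Prime]

theorem T_succ {n : ℤ} (hn : n ∈ T (p + 1)) : ∃ (e : ℕ) (m : ℤ), m ∈ T p ∧ n = p ^ e * m := by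
  induction hn using Submonoid.closure_induction with
  | mem x hx =>
    have hx : |x| < (p + 1 : ℕ) := hx
    push_cast at hx
    have h2 := hp.out.two_le
    rcases lt_or_ge |x| (p : ℤ) with h | h
    · exact ⟨0, x, mem_T h, by simp⟩
    · have : |x| = p := by omega
      rcases (abs_eq (by omega)).1 this with h | h
      · exact ⟨1, 1, one_mem _, by simp [h]⟩
      · exact ⟨1, -1, mem_T (by simp; omega), by simp [h]⟩
  | one => exact ⟨0, 1, one_mem _, by simp⟩
  | mul x y hx hy ihx ihy =>
    obtain ⟨e, m, hm, rfl⟩ := ihx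
    obtain ⟨e', m', hm', rfl⟩ := ihy
    exact ⟨e + e', m * m', mul_mem hm hm', by ring⟩

theorem T_not_dvd {n : ℤ} (hn : n ∈ T p) : n = 0 ∨ ¬ (p : ℤ) ∣ n := by
  have hpp : Prime (p : ℤ) := Nat.prime_iff_prime_int.1 hp.out
  induction hn using Submonoid.closure_induction with
  | mem x hx =>
    have hx : |x| < p := hx
    by_cases h : x = 0
    · exact Or.inl h
    · refine Or.inr fun hd => h (Int.eq_zero_of_abs_lt_dvd hd hx)
  | one => exact Or.inr hpp.not_dvd_one
  | mul x y hx hy ihx ihy =>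
    rcases ihx with h | h
    · simp [h]
    rcases ihy with h' | h'
    · simp [h']
    exact Or.inr fun hd => (hpp.dvd_or_dvd hd).elim h h'

theorem exists_list {x : W ℚ} (hx : x ∈ S (p + 1)) :
    ∃ l : List (ZMod p), (l.map (g p)).sum = QuotientAddGroup.mk x := by
  have hp0 : (p : ℤ) ≠ 0 := by exact_mod_cast hp.out.ne_zero
  induction hx using AddSubgroup.closure_induction with
  | mem x hx =>
    obtain ⟨n, hn, rfl⟩ := hx
    obtain ⟨e, m, hm, rfl⟩ := T_succ hn
    rcases Nat.even_or_odd' e with ⟨k, rfl | rfl⟩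
    · refine ⟨[], ?_⟩
      rw [show (p : ℤ) ^ (2 * k) * m = m * (p ^ k) ^ 2 by ring, wz_sq _ (pow_ne_zero _ hp0)]
      simp only [List.map_nil, List.sum_nil]
      exact ((QuotientAddGroup.eq_zero_iff _).2 (wz_mem hm)).symm
    · refine ⟨[(m : ZMod p)], ?_⟩
      rw [show (p : ℤ) ^ (2 * k + 1) * m = (p * m) * (p ^ k) ^ 2 by ring,
        wz_sq _ (pow_ne_zero _ hp0), g_of hm]
      simp
  | zero => exact ⟨[], by simp⟩
  | add x y hx hy ihx ihy =>
    obtain ⟨s, hs⟩ := ihx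
    obtain ⟨t, ht⟩ := ihy
    exact ⟨s ++ t, by simp [hs, ht]⟩
  | neg x hx ihx =>
    obtain ⟨s, hs⟩ := ihx
    refine ⟨s.map Neg.neg, ?_⟩
    rw [QuotientAddGroup.mk_neg, ← hs]
    clear hs
    induction s with
    | nil => simp
    | cons a s ih => simp only [List.map_cons, List.sum_cons, ih, g_neg]; abel

theorem exists_fin' {α : Type} (s : Multiset α) :
    ∃ (n : ℕ) (a : Fin n → α), Finset.univ.val.map a = s := by
  obtain ⟨l, rfl⟩ := Quot.exists_rep s
  exact ⟨l.length, l.get, by simp⟩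

theorem exists_isotropic {x : W ℚ} (hloc : LocZero ℚ_[p] x) (l : List (ZMod p)) (hl : l ≠ [])
    (h : (l.map (g p)).sum = QuotientAddGroup.mk x) :
    ∃ y : Fin l.length → ZMod p, y ≠ 0 ∧ ∑ j, l.get j * y j ^ 2 = 0 := by
  classical
  by_cases h0 : ∃ j, l.get j = 0
  · obtain ⟨j, hj⟩ := h0
    refine ⟨Pi.single j 1, by simp, ?_⟩
    refine Finset.sum_eq_zero fun i _ => ?_
    by_cases hij : i = j
    · subst hij; rw [hj]; simp
    · simp [hij]
  push Not at h0
  have hp0 : (p : ℤ) ≠ 0 := by exact_mod_cast hp.out.ne_zero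
  have hs : x - ∑ j, wz (p * ((l.get j).val : ℤ)) ∈ S p := by
    rw [← QuotientAddGroup.eq_zero_iff]
    have e : (l.map (g p)).sum = ∑ j, g p (l.get j) := by
      conv_lhs => rw [← List.ofFn_get l, List.map_ofFn, List.sum_ofFn]
      rfl
    have e2 : (QuotientAddGroup.mk (∑ j, wz (p * ((l.get j).val : ℤ))) : W ℚ ⧸ S p) =
        ∑ j, g p (l.get j) := map_sum (QuotientAddGroup.mk' (S p)) _ _
    rw [QuotientAddGroup.mk_sub, ← h, e, e2, sub_self]
  obtain ⟨s, hsT, hsx⟩ := S_rep hp.out.two_le hs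
  obtain ⟨n, u, rfl⟩ := exists_fin' s
  have hx : mk (Finset.univ.val.map (Sum.elim (fun i => ((u i : ℤ) : ℚ))
      (fun j => (((p : ℤ) * ((l.get j).val : ℤ) : ℤ) : ℚ)))) = x := by
    have h2 := sub_eq_iff_eq_add.1 hsx.symm
    rw [Multiset.map_map] at h2
    rw [map_sum_elim, mk_add, mk_eq_sum, mk_eq_sum, Multiset.map_map, Multiset.map_map]
    exact h2.symm
  have hu : ∀ i, u i ∈ T p ∧ u i ≠ 0 := fun i => hsT _ (Multiset.mem_map_of_mem _ (Finset.mem_univ i))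
  have hz := hloc _ hx
  rw [Multiset.map_map] at hz
  have hne : Nonempty (Fin l.length) := ⟨⟨0, List.length_pos_iff.2 hl⟩⟩
  obtain ⟨X, hX1, hX2⟩ := lagrangian _ (by
    rintro (i | j)
    · simpa using (hu i).2
    · have := h0 j
      have hv : (l.get j).val ≠ 0 := (ZMod.val_ne_zero _).2 this
      simp only [Function.comp_apply, Sum.elim_inr, Rat.coe_castHom]
      rw [Rat.cast_intCast]
      exact_mod_cast mul_ne_zero hp0 (Int.natCast_ne_zero.2 hv)) hz
  obtain ⟨y, hy0, hy⟩ := local_isotropic (p := p) u (fun j => ((l.get j).val : ℤ))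
    (fun i => (T_not_dvd (hu i).1).resolve_left (hu i).2) X (by
      intro x hx y hy
      rw [← hX1 x hx y hy]
      refine Finset.sum_congr rfl fun i _ => ?_
      rcases i with i | j
      · simp
      · simp only [Function.comp_apply, Sum.elim_inr, Rat.coe_castHom, Rat.cast_intCast,
          Int.cast_mul, Int.cast_natCast, Rat.cast_mul, Rat.cast_natCast]) hX2
  refine ⟨y, hy0, ?_⟩
  rw [← hy]
  refine Finset.sum_congr rfl fun j _ => ?_
  simp

theorem step {x : W ℚ} (hloc : LocZero ℚ_[p] x) (hx : x ∈ S (p + 1)) : x ∈ S p := by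
  have key : ∀ n : ℕ, ∀ l : List (ZMod p), l.length = n →
      (l.map (g p)).sum = QuotientAddGroup.mk x → x ∈ S p := by
    intro n
    induction n using Nat.strong_induction_on with
    | _ n ih =>
      intro l hl h
      by_cases hnil : l = []
      · subst hnil
        rw [← QuotientAddGroup.eq_zero_iff, ← h]
        simp
      · obtain ⟨y, hy0, hy⟩ := exists_isotropic hloc l hnil h
        obtain ⟨l', h1, h2⟩ := list_reduce' (g p) g_zero g_add (fun a c hc => g_sq a hc) l y hy0 hy
        exact ih l'.length (hl ▸ h1) l' rfl (h2.trans h)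
  obtain ⟨l, hl⟩ := exists_list hx
  exact key _ l rfl hl

end step

theorem T_not_prime {k : ℕ} (hk : 2 ≤ k) (hnp : ¬ k.Prime) : T (k + 1) ≤ T k := by
  rw [T, Submonoid.closure_le]
  intro x hx
  have hx : |x| < (k + 1 : ℕ) := hx
  push_cast at hx
  rcases lt_or_ge |x| (k : ℤ) with h | h
  · exact mem_T h
  · have hxk : |x| = k := by omega
    obtain ⟨a, b, ha, hb, hab⟩ : ∃ a b : ℕ, a < k ∧ b < k ∧ k = a * b := by
      obtain ⟨a, ⟨b, hab⟩, h1, h2⟩ := Nat.exists_dvd_of_not_prime2 hk hnp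
      refine ⟨a, b, h2, ?_, hab⟩
      have : b ≠ 0 := by rintro rfl; omega
      nlinarith [Nat.pos_of_ne_zero this]
    have hkT : (k : ℤ) ∈ T k := by
      have h3 : (k : ℤ) = a * b := by exact_mod_cast hab
      rw [h3]
      exact mul_mem (mem_T (by simpa using ha)) (mem_T (by simpa using hb))
    rcases (abs_eq (by omega)).1 hxk with h | h
    · rw [h]; exact hkT
    · rw [h, ← neg_one_mul]
      exact mul_mem (mem_T (by simp; omega)) hkT

theorem exists_mem_S (x : W ℚ) : ∃ k, x ∈ S k := by
  obtain ⟨s, rfl⟩ := mk_surj x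
  induction s using Multiset.induction with
  | empty => exact ⟨0, by rw [mk_zero]; exact zero_mem _⟩
  | cons a s ih =>
    obtain ⟨k, hk⟩ := ih
    let n : ℤ := a.num * a.den
    have hn : wz n = w a := by
      have := w_sq a (c := (a.den : ℚ)) (by exact_mod_cast a.den_ne_zero)
      rw [← this, wz]
      congr 1
      simp only [n]
      push_cast
      rw [pow_two, ← mul_assoc, Rat.mul_den_eq_num]
    refine ⟨max k (n.natAbs + 1), ?_⟩
    rw [← Multiset.singleton_add, mk_add]
    refine add_mem ?_ (S_mono_of (T_mono (le_max_left _ _)) hk)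
    change w a ∈ _
    rw [← hn]
    refine wz_mem (mem_T ?_)
    push_cast
    omega

theorem mem_S_two {x : W ℚ} (h : ∀ (p : ℕ) [Fact p.Prime], LocZero ℚ_[p] x) : x ∈ S 2 := by
  have key : ∀ k, x ∈ S k → x ∈ S 2 := by
    intro k
    induction k with
    | zero => exact fun hx => S_mono_of (T_mono (by omega)) hx
    | succ k ih =>
      intro hx
      by_cases hk : k < 2
      · exact S_mono_of (T_mono (by omega)) hx
      by_cases hp : k.Prime
      · haveI : Fact k.Prime := ⟨hp⟩
        exact ih (step (h k) hx)
      · exact ih (S_mono_of (T_not_prime (by omega) hp) hx)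
  obtain ⟨k, hk⟩ := exists_mem_S x
  exact key k hk

theorem S_two {x : W ℚ} (hx : x ∈ S 2) : ∃ z : ℤ, x = z • wz 1 := by
  induction hx using AddSubgroup.closure_induction with
  | mem x hx =>
    obtain ⟨n, hn, rfl⟩ := hx
    have : n = 0 ∨ n = 1 ∨ n = -1 := by
      have hn : n ∈ T 2 := hn
      induction hn using Submonoid.closure_induction with
      | mem x hx =>
        have hx : |x| < (2 : ℕ) := hx
        rw [abs_lt] at hx
        omega
      | one => simp
      | mul x y hx hy ihx ihy =>
        rcases ihx hx with rfl | rfl | rfl <;> rcases ihy hy with rfl | rfl | rfl <;> simp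
    rcases this with rfl | rfl | rfl
    · exact ⟨0, by simp [wz_zero]⟩
    · exact ⟨1, by simp⟩
    · exact ⟨-1, by simp [wz_neg]⟩
  | zero => exact ⟨0, by simp⟩
  | add x y hx hy ihx ihy =>
    obtain ⟨s, rfl⟩ := ihx
    obtain ⟨t, rfl⟩ := ihy
    exact ⟨s + t, by rw [add_smul]⟩
  | neg x hx ihx =>
    obtain ⟨s, rfl⟩ := ihx
    exact ⟨-s, by rw [neg_smul]⟩

theorem real_zero {x : W ℚ} (hR : LocZero ℝ x) (n : ℕ) (ε : ℤ) (hε : ε = 1 ∨ ε = -1)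
    (hx : x = n • wz ε) : x = 0 := by
  have hmk : mk (Finset.univ.val.map (fun _ : Fin n => (ε : ℚ))) = x := by
    rw [mk_eq_sum, Multiset.map_map, hx]
    simp [wz]
  have hz := hR _ hmk
  rw [Multiset.map_map] at hz
  have hε0 : ε ≠ 0 := by rcases hε with rfl | rfl <;> simp
  obtain ⟨X, h1, h2⟩ := lagrangian _ (by intro i; simpa using hε0) hz
  have hX : X = ⊥ := by
    rw [eq_bot_iff]
    intro v hv
    have := h1 v hv v hv
    simp only [Function.comp_apply, Rat.coe_castHom, mul_assoc] at this
    rw [← Finset.mul_sum] at this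
    have h3 := (mul_eq_zero.1 this).resolve_left (by simpa using hε0)
    rw [Finset.sum_eq_zero_iff_of_nonneg (fun i _ => mul_self_nonneg _)] at h3
    ext i
    exact mul_self_eq_zero.1 (h3 i (Finset.mem_univ i))
  rw [hX] at h2
  simp at h2
  subst h2
  simp [hx]

theorem witt_hasse {x : W ℚ} (h : ∀ (p : ℕ) [Fact p.Prime], LocZero ℚ_[p] x) (hR : LocZero ℝ x) :
    x = 0 := by
  obtain ⟨z, hz⟩ := S_two (mem_S_two h)
  rcases Int.eq_nat_or_neg z with ⟨n, rfl | rfl⟩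
  · exact real_zero hR n 1 (Or.inl rfl) (by simpa using hz)
  · exact real_zero hR n (-1) (Or.inr rfl) (by rw [hz, wz_neg]; simp)

end HasseW
namespace HasseW

open Matrix

def gram (L : EvenLattice) (K : Type) [Field K] : Matrix (Fin L.n) (Fin L.n) K :=
  L.B.map (Int.cast : ℤ → K)

theorem formR_eq (L : EvenLattice) (K : Type) [Field K] (x y : Fin L.n → K) :
    formR L K x y = x ⬝ᵥ (gram L K *ᵥ y) := by
  simp only [formR, gram, dotProduct, mulVec, Matrix.map_apply, Finset.mul_sum]
  refine Finset.sum_congr rfl fun i _ => Finset.sum_congr rfl fun j _ => ?_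
  ring

theorem gram_det (L : EvenLattice) (K : Type) [Field K] [CharZero K] : (gram L K).det ≠ 0 := by
  have h : (gram L K).det = (L.B.det : K) := ((Int.castRingHom K).map_det L.B).symm
  rw [h]
  exact_mod_cast L.nondeg

theorem gram_symm (L : EvenLattice) (K : Type) [Field K] : (gram L K).IsSymm := L.symm.map _

theorem gram_map (L : EvenLattice) (K : Type) [Field K] [CharZero K] :
    (gram L ℚ).map (Rat.castHom K) = gram L K := by
  ext i j
  simp [gram]

theorem matrix_ext_form {K : Type} [Field K] {n : ℕ} {A B : Matrix (Fin n) (Fin n) K}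
    (h : ∀ x y : Fin n → K, x ⬝ᵥ (A *ᵥ y) = x ⬝ᵥ (B *ᵥ y)) : A = B := by
  ext i j
  simpa using h (Pi.single i 1) (Pi.single j 1)

theorem form_congr {K : Type} [Field K] {m n : ℕ} (P : Matrix (Fin m) (Fin n) K)
    (A : Matrix (Fin m) (Fin m) K) (x y : Fin n → K) :
    (P *ᵥ x) ⬝ᵥ (A *ᵥ (P *ᵥ y)) = x ⬝ᵥ ((Pᵀ * A * P) *ᵥ y) := by
  rw [← Matrix.mulVec_mulVec, ← Matrix.mulVec_mulVec, Matrix.dotProduct_mulVec x Pᵀ,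
    Matrix.vecMul_transpose]

theorem isometricOver_iff (L M : EvenLattice) (K : Type) [Field K] [CharZero K] :
    IsometricOver K L M ↔ L.n = M.n ∧ Rep (gram M K) (gram L K) := by
  constructor
  · rintro ⟨e, he⟩
    refine ⟨by simpa using e.finrank_eq, LinearMap.toMatrix' (e : (Fin L.n → K) →ₗ[K] _), ?_⟩
    refine matrix_ext_form fun x y => ?_
    rw [← form_congr, ← formR_eq, ← formR_eq, ← he x y, LinearMap.toMatrix'_mulVec,
      LinearMap.toMatrix'_mulVec]
    rfl
  · rintro ⟨hn, P, hP⟩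
    have h1 : ((gram L K)⁻¹ * (Pᵀ * gram M K)) * P = 1 := by
      rw [Matrix.mul_assoc, hP]
      exact Matrix.nonsing_inv_mul _ (isUnit_iff_ne_zero.mpr (gram_det L K))
    have h2 := (Matrix.mul_eq_one_comm_of_card_eq _ _ _ (by simp [hn])).mpr h1
    refine ⟨Matrix.toLin'OfInv h1 h2, fun x y => ?_⟩
    rw [formR_eq, formR_eq]
    have h3 := form_congr P (gram M K) x y
    rw [hP] at h3
    exact h3

theorem exists_diag (L : EvenLattice) : ∃ a : Fin L.n → ℚ, Rep (gram L ℚ) (diagonal a) ∧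
    Rep (diagonal a) (gram L ℚ) ∧ ∀ i, a i ≠ 0 := by
  have : Invertible (2 : ℚ) := invertibleOfNonzero two_ne_zero
  have hs : LinearMap.IsSymm (Matrix.toBilin' (gram L ℚ)) := by
    constructor
    intro x y
    simp only [Matrix.toBilin'_apply', RingHom.id_apply]
    rw [Matrix.dotProduct_mulVec, ← Matrix.mulVec_transpose, (gram_symm L ℚ).eq, dotProduct_comm]
  obtain ⟨v, hv⟩ := LinearMap.BilinForm.exists_orthogonal_basis hs
  let f : Fin L.n ≃ Fin (Module.finrank ℚ (Fin L.n → ℚ)) := finCongr (by simp)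
  let v' := v.reindex f.symm
  let P : Matrix (Fin L.n) (Fin L.n) ℚ := (Pi.basisFun ℚ (Fin L.n)).toMatrix v'
  have hPdet : P.det ≠ 0 := by
    have h := congrArg Matrix.det ((Pi.basisFun ℚ (Fin L.n)).toMatrix_mul_toMatrix_flip v')
    rw [det_mul, det_one] at h
    exact left_ne_zero_of_mul_eq_one h
  have hP : Pᵀ * gram L ℚ * P = diagonal (fun i => (Pᵀ * gram L ℚ * P) i i) := by
    ext i j
    by_cases hij : i = j
    · subst hij; simp
    · rw [diagonal_apply_ne _ hij]
      have h1 : (P *ᵥ Pi.single i 1) ⬝ᵥ (gram L ℚ *ᵥ (P *ᵥ Pi.single j 1)) = 0 := by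
        have h2 : Matrix.toBilin' (gram L ℚ) (v (f i)) (v (f j)) = 0 := hv (f.injective.ne hij)
        rw [Matrix.toBilin'_apply'] at h2
        have e : ∀ k, P *ᵥ Pi.single k 1 = v (f k) := by
          intro k; ext i; simp [P, v', Module.Basis.toMatrix]
        rw [e, e]
        exact h2
      rw [form_congr] at h1
      simpa using h1
  have hd : (diagonal (fun i => (Pᵀ * gram L ℚ * P) i i)).det ≠ 0 := by
    rw [← hP, det_mul, det_mul, det_transpose]
    exact mul_ne_zero (mul_ne_zero hPdet (gram_det L ℚ)) hPdet
  have hr : Rep (gram L ℚ) (diagonal (fun i => (Pᵀ * gram L ℚ * P) i i)) := ⟨P, hP⟩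
  refine ⟨_, hr, hr.symm rfl hd, ?_⟩
  rw [det_diagonal] at hd
  intro i hi
  exact hd (Finset.prod_eq_zero (Finset.mem_univ i) hi)

theorem zero_notMem_map {n : ℕ} {a : Fin n → ℚ} (h : ∀ i, a i ≠ 0) :
    (0 : ℚ) ∉ Finset.univ.val.map a := by
  intro h0
  obtain ⟨i, _, hi⟩ := Multiset.mem_map.1 h0
  exact h i hi

theorem locZero_of {L M : EvenLattice} {a : Fin L.n → ℚ} {b : Fin M.n → ℚ}
    (ha : Rep (diagonal a) (gram L ℚ)) (hb : Rep (gram M ℚ) (diagonal b))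
    (hb' : ∀ i, b i ≠ 0) (ha' : ∀ i, a i ≠ 0)
    (K : Type) [Field K] [NeZero (2 : K)] [CharZero K] (h : IsometricOver K L M) :
    LocZero K (mk (Finset.univ.val.map a) - mk (Finset.univ.val.map b)) := by
  obtain ⟨hn, hr⟩ := (isometricOver_iff L M K).1 h
  have hr' : Rep (gram L K) (gram M K) := hr.symm (by simp [hn]) (gram_det L K)
  have e1 := ha.map (Rat.castHom K)
  have e2 := hb.map (Rat.castHom K)
  rw [gram_map, diagonal_map (map_zero _)] at e1 e2
  have e := iso_of _ _ (by simp [hn]) ((e1.trans hr').trans e2)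
  have c0 : ∀ {n : ℕ} {a : Fin n → ℚ}, (∀ i, a i ≠ 0) →
      (0 : K) ∉ (Finset.univ.val.map a).map (Rat.castHom K) := by
    intro n a ha h0
    obtain ⟨q, hq, h1⟩ := Multiset.mem_map.1 h0
    rw [map_eq_zero] at h1
    exact zero_notMem_map ha (h1 ▸ hq)
  have hw : mk ((Finset.univ.val.map a).map (Rat.castHom K)) =
      mk ((Finset.univ.val.map b).map (Rat.castHom K)) := by
    rw [mk_eq]
    apply wittCon_of_iso
    rw [nz_eq (c0 ha'), nz_eq (c0 hb')]
    rw [Multiset.map_map, Multiset.map_map]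
    exact e
  intro s hs
  have h3 : mk (s + Finset.univ.val.map b) = mk (Finset.univ.val.map a) := by
    rw [mk_add, hs, sub_add_cancel]
  have h4 := mk_eq.2 (wittCon_map (Rat.castHom K) (mk_eq.1 h3))
  rw [Multiset.map_add, mk_add, hw] at h4
  exact add_eq_right.1 h4

theorem main (L M : EvenLattice) :
    IsometricOver ℚ L M ↔
      ((∀ (p : ℕ) [Fact p.Prime], IsometricOver ℚ_[p] L M) ∧ IsometricOver ℝ L M) := by
  constructor
  · intro h
    obtain ⟨hn, hr⟩ := (isometricOver_iff L M ℚ).1 h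
    have key : ∀ (K : Type) [Field K] [CharZero K], IsometricOver K L M := by
      intro K _ _
      have := hr.map (Rat.castHom K)
      rw [gram_map, gram_map] at this
      exact (isometricOver_iff L M K).2 ⟨hn, this⟩
    exact ⟨fun p _ => key _, key _⟩
  · rintro ⟨hp, hR⟩
    have hn := ((isometricOver_iff L M ℝ).1 hR).1
    obtain ⟨a, ha, ha1, ha2⟩ := exists_diag L
    obtain ⟨b, hb, hb1, hb2⟩ := exists_diag M
    have hz := witt_hasse (fun p _ => locZero_of ha1 hb hb2 ha2 ℚ_[p] (hp p))
      (locZero_of ha1 hb hb2 ha2 ℝ hR)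
    have hi := iso_of_wittCon (zero_notMem_map hb2) (zero_notMem_map ha2) (by simp [hn])
      (mk_eq.1 (sub_eq_zero.1 hz).symm)
    exact (isometricOver_iff L M ℚ).2 ⟨hn, (hb.trans hi.rep).trans ha1⟩

end HasseW

/-- **Hasse principle for rational equivalence.** Two even lattices are isometric over `ℚ`
if and only if they are isometric over `ℚ_p` for every prime `p` and over `ℝ`. -/
theorem hasse_principle_for_lattices (L M : EvenLattice) :
    IsometricOver ℚ L M ↔
      ((∀ (p : ℕ) [Fact p.Prime], IsometricOver ℚ_[p] L M) ∧ IsometricOver ℝ L M) := by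
  exact HasseW.main L M
end

section
/- Let L be an even lattice. Then every even overlattice K of L satisfies L ⊆ K ⊆ L*, and the assignment K ↦ K/L is a bijection between the set of even overlattices of L and the set of isotropic subgroups of the discriminant form (L*/L, q_L), that is, subgroups C ⊆ L*/L with q_L(c) = 0 for all c ∈ C. -/
open scoped BigOperators

/-- `K` is an even overlattice of `L`: a subgroup of `L ⊗ ℚ` containing `L` on which the
extended bilinear form is integral and the associated quadratic form is even. -/
def IsEvenOverlattice (L : EvenLattice) (K : AddSubgroup (Fin L.n → ℚ)) : Prop :=
  intSub L ≤ K ∧ (∀ x ∈ K, ∀ y ∈ K, ∃ m : ℤ, formR L ℚ x y = m) ∧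
    (∀ x ∈ K, ∃ m : ℤ, formR L ℚ x x = 2 * m)

/-- The subgroup `K/L` of the discriminant group `L^*/L` attached to an overlattice `K`. -/
def overToSub (L : EvenLattice) (K : AddSubgroup (Fin L.n → ℚ)) : AddSubgroup (discGroup L) :=
  AddSubgroup.map (QuotientAddGroup.mk' ((intSub L).addSubgroupOf (dualSub L)))
    (K.addSubgroupOf (dualSub L))

theorem formR_comm' (L : EvenLattice) (R : Type*) [CommRing R] (x y : Fin L.n → R) :
    formR L R x y = formR L R y x := by
  unfold formR
  rw [Finset.sum_comm]
  refine Finset.sum_congr rfl fun i _ => Finset.sum_congr rfl fun j _ => ?_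
  rw [L.symm.apply i j]
  ring

theorem formR_add_sq (L : EvenLattice) (R : Type*) [CommRing R] (x y : Fin L.n → R) :
    formR L R (x + y) (x + y) = formR L R x x + 2 * formR L R x y + formR L R y y := by
  rw [formR_add_left, formR_comm' L R x (x + y), formR_comm' L R y (x + y),
    formR_add_left, formR_add_left, formR_comm' L R y x]
  ring

theorem formR_zmod_two (L : EvenLattice) (z : Fin L.n → ZMod 2) :
    formR L (ZMod 2) z z = 0 := by
  unfold formR
  rw [← Finset.sum_product']
  refine Finset.sum_involution (fun p _ => (p.2, p.1)) ?_ ?_ ?_ ?_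
  · rintro ⟨i, j⟩ _
    simp only
    rw [L.symm.apply i j, mul_right_comm]
    exact CharTwo.add_self_eq_zero _
  · rintro ⟨i, j⟩ _ h heq
    simp only [Prod.mk.injEq] at heq
    obtain ⟨rfl, _⟩ := heq
    apply h
    have : ((L.B j j : ℤ) : ZMod 2) = 0 :=
      (ZMod.intCast_zmod_eq_zero_iff_dvd _ 2).2 (by exact_mod_cast L.even_diag j)
    simp [this]
  · intros; simp
  · intros; rfl

theorem formR_int_even (L : EvenLattice) (x : Fin L.n → ℚ) (hx : x ∈ intSub L) :
    ∃ m : ℤ, formR L ℚ x x = 2 * m := by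
  choose z hz using hx
  have h1 : formR L ℚ x x = ((formR L ℤ z z : ℤ) : ℚ) := by
    simp [formR, hz]
  have h2 : ((formR L ℤ z z : ℤ) : ZMod 2) = 0 := by
    rw [← formR_zmod_two L (fun i => (z i : ZMod 2))]
    simp [formR]
  obtain ⟨m, hm⟩ := (ZMod.intCast_zmod_eq_zero_iff_dvd _ 2).1 h2
  exact ⟨m, by rw [h1, hm]; push_cast; ring⟩

theorem intSub_le_dual (L : EvenLattice) : intSub L ≤ dualSub L := by
  intro x hx y hy
  choose z hz using hx
  choose w hw using hy
  exact ⟨formR L ℤ z w, by simp [formR, hz, hw]⟩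

theorem mk2_eq_zero (r : ℚ) : (QuotientAddGroup.mk r : Qmod2Z) = 0 ↔ ∃ m : ℤ, r = 2 * m := by
  rw [QuotientAddGroup.eq_zero_iff, AddSubgroup.mem_zmultiples_iff]
  refine exists_congr fun m => ?_
  rw [zsmul_eq_mul, mul_comm, eq_comm]

theorem discQ_mk (L : EvenLattice) (x : dualSub L) :
    discQ L (QuotientAddGroup.mk x) = 0 ↔ ∃ m : ℤ, formR L ℚ (x : Fin L.n → ℚ) x = 2 * m := by
  unfold discQ discQOf
  rw [mk2_eq_zero]
  obtain ⟨l, hl⟩ := QuotientAddGroup.mk_out_eq_mul ((intSub L).addSubgroupOf (dualSub L)) x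
  rw [hl]
  have hl' : ((l : dualSub L) : Fin L.n → ℚ) ∈ intSub L := l.2
  obtain ⟨a, ha⟩ := x.2 _ hl'
  obtain ⟨b, hb⟩ := formR_int_even L _ hl'
  rw [AddSubgroup.coe_add, formR_add_sq, ha, hb]
  constructor
  · rintro ⟨m, hm⟩
    exact ⟨m - a - b, by push_cast; linarith⟩
  · rintro ⟨m, hm⟩
    exact ⟨m + a + b, by push_cast; linarith⟩

theorem mem_overToSub (L : EvenLattice) (K : AddSubgroup (Fin L.n → ℚ)) (hK : intSub L ≤ K)
    (x : dualSub L) :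
    (QuotientAddGroup.mk x : discGroup L) ∈ overToSub L K ↔ (x : Fin L.n → ℚ) ∈ K := by
  unfold overToSub
  rw [AddSubgroup.mem_map]
  constructor
  · rintro ⟨y, hy, hyx⟩
    have h := QuotientAddGroup.eq.1 hyx
    have h2 : ((-y + x : dualSub L) : Fin L.n → ℚ) ∈ K := hK h
    have hy' : (y : Fin L.n → ℚ) ∈ K := hy
    have := K.add_mem hy' h2
    simpa using this
  · intro h
    exact ⟨x, h, rfl⟩

/-- **Overlattices correspond to isotropic subgroups.** Every even overlattice `K` of `L`
satisfies `L ⊆ K ⊆ L^*`, and `K ↦ K/L` is a bijection from the set of even overlattices of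
`L` onto the set of isotropic subgroups of the discriminant form `(L^*/L, q_L)`. -/
theorem even_overlattices_biject_with_isotropic_subgroups (L : EvenLattice) :
    (∀ K : AddSubgroup (Fin L.n → ℚ), IsEvenOverlattice L K → K ≤ dualSub L) ∧
    Set.BijOn (overToSub L) {K | IsEvenOverlattice L K}
      {C : AddSubgroup (discGroup L) | ∀ c ∈ C, discQ L c = 0} := by
  have hd : ∀ K : AddSubgroup (Fin L.n → ℚ), IsEvenOverlattice L K → K ≤ dualSub L :=
    fun K hK x hx y hy => hK.2.1 x hx y (hK.1 hy)
  refine ⟨hd, ?_, ?_, ?_⟩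
  · intro K hK c hc
    induction c using QuotientAddGroup.induction_on with
    | H x =>
      rw [discQ_mk]
      exact hK.2.2 _ ((mem_overToSub L K hK.1 x).1 hc)
  · intro K hK K' hK' h
    ext x
    constructor
    · intro hx
      have := (mem_overToSub L K hK.1 ⟨x, hd K hK hx⟩).2 hx
      rw [h] at this
      exact (mem_overToSub L K' hK'.1 _).1 this
    · intro hx
      have := (mem_overToSub L K' hK'.1 ⟨x, hd K' hK' hx⟩).2 hx
      rw [← h] at this
      exact (mem_overToSub L K hK.1 _).1 this
  · intro C hC
    let K : AddSubgroup (Fin L.n → ℚ) :=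
      (C.comap (QuotientAddGroup.mk' ((intSub L).addSubgroupOf (dualSub L)))).map
        (dualSub L).subtype
    have hmem : ∀ x : dualSub L, (x : Fin L.n → ℚ) ∈ K ↔ (QuotientAddGroup.mk x : discGroup L) ∈ C := by
      intro x
      constructor
      · rintro ⟨y, hy, hyx⟩
        have : y = x := Subtype.ext hyx
        subst this
        exact hy
      · intro h
        exact ⟨x, h, rfl⟩
    have hKd : K ≤ dualSub L := by
      rintro _ ⟨y, _, rfl⟩
      exact y.2
    have hev : ∀ x ∈ K, ∃ m : ℤ, formR L ℚ x x = 2 * m := by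
      intro x hx
      exact (discQ_mk L ⟨x, hKd hx⟩).1 (hC _ ((hmem ⟨x, hKd hx⟩).1 hx))
    have hLK : intSub L ≤ K := by
      intro x hx
      refine (hmem ⟨x, intSub_le_dual L hx⟩).2 ?_
      have : (QuotientAddGroup.mk ⟨x, intSub_le_dual L hx⟩ : discGroup L) = 0 :=
        (QuotientAddGroup.eq_zero_iff _).2 hx
      rw [this]
      exact C.zero_mem
    refine ⟨K, ⟨hLK, ?_, hev⟩, ?_⟩
    · intro x hx y hy
      obtain ⟨a, ha⟩ := hev x hx
      obtain ⟨b, hb⟩ := hev y hy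
      obtain ⟨c, hc⟩ := hev _ (K.add_mem hx hy)
      rw [formR_add_sq] at hc
      exact ⟨c - a - b, by push_cast; linarith⟩
    · ext c
      induction c using QuotientAddGroup.induction_on with
      | H x => rw [mem_overToSub L K hLK, hmem]
end

section
/- Let L be an even lattice and let K and K' be even overlattices of L with corresponding isotropic subgroups C = K/L and C' = K'/L of the discriminant form (L*/L, q_L). Then there exists an isometry from K to K' mapping L onto L if and only if there exists a self-isometry of L whose induced isometry of (L*/L, q_L) maps C onto C'. -/
open scoped BigOperators

/-- The `ℚ`-linear extension of a `ℤ`-linear automorphism of `ℤ^n` to `ℚ^n`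
(via its matrix). -/
noncomputable def matExt (L : EvenLattice) (σ : (Fin L.n → ℤ) ≃ₗ[ℤ] (Fin L.n → ℤ)) :
    (Fin L.n → ℚ) →ₗ[ℚ] (Fin L.n → ℚ) :=
  Matrix.toLin'
    ((LinearMap.toMatrix' (σ : (Fin L.n → ℤ) →ₗ[ℤ] (Fin L.n → ℤ))).map (Int.cast : ℤ → ℚ))

def cv (L : EvenLattice) (z : Fin L.n → ℤ) : Fin L.n → ℚ := fun i => (z i : ℚ)

theorem cv_inj (L : EvenLattice) {z w : Fin L.n → ℤ} (h : cv L z = cv L w) : z = w := by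
  funext i
  have := congrFun h i
  simpa [cv] using this

theorem cv_add (L : EvenLattice) (z w : Fin L.n → ℤ) : cv L (z + w) = cv L z + cv L w := by
  funext i
  simp [cv]

theorem cv_mem (L : EvenLattice) (z : Fin L.n → ℤ) : cv L z ∈ intSub L := fun i => ⟨z i, rfl⟩

theorem exists_cv (L : EvenLattice) {x : Fin L.n → ℚ} (h : x ∈ intSub L) : ∃ z, cv L z = x := by
  choose z hz using h
  exact ⟨z, funext fun i => (hz i).symm⟩

theorem exists_mul_cv (L : EvenLattice) (x : Fin L.n → ℚ) :
    ∃ N : ℤ, N ≠ 0 ∧ ∃ z, N • x = cv L z := by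
  obtain ⟨b, hb⟩ := IsLocalization.exist_integer_multiples_of_finite (nonZeroDivisors ℤ) x
  choose z hz using hb
  refine ⟨b, nonZeroDivisors.ne_zero b.2, z, ?_⟩
  funext i
  have := hz i
  simp [cv] at this ⊢
  exact this.symm

theorem form_cv (L : EvenLattice) (z w : Fin L.n → ℤ) :
    formR L ℚ (cv L z) (cv L w) = (formR L ℤ z w : ℚ) := by
  simp [formR, cv]

theorem form_zsmul (L : EvenLattice) (N M : ℤ) (x y : Fin L.n → ℚ) :
    formR L ℚ (N • x) (M • y) = N * M * formR L ℚ x y := by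
  simp only [formR, Finset.mul_sum]
  refine Finset.sum_congr rfl fun i _ => Finset.sum_congr rfl fun j _ => ?_
  simp
  ring

theorem matExt_cv (L : EvenLattice) (σ : (Fin L.n → ℤ) ≃ₗ[ℤ] (Fin L.n → ℤ)) (z : Fin L.n → ℤ) :
    matExt L σ (cv L z) = cv L (σ z) := by
  have h : σ z = (LinearMap.toMatrix' (σ : (Fin L.n → ℤ) →ₗ[ℤ] (Fin L.n → ℤ))).mulVec z := by
    rw [← Matrix.toLin'_apply, Matrix.toLin'_toMatrix']
    rfl
  rw [h]
  funext i
  simp [matExt, cv, Matrix.toLin'_apply, Matrix.mulVec, dotProduct]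

theorem zsmul_cancel (L : EvenLattice) {N : ℤ} (hN : N ≠ 0) {x y : Fin L.n → ℚ}
    (h : N • x = N • y) : x = y := by
  funext i
  have := congrFun h i
  simpa [hN] using this

theorem matExt_symm (L : EvenLattice) (σ σ' : (Fin L.n → ℤ) ≃ₗ[ℤ] (Fin L.n → ℤ))
    (h : ∀ z, σ (σ' z) = z) (x : Fin L.n → ℚ) :
    matExt L σ (matExt L σ' x) = x := by
  obtain ⟨N, hN, z, hz⟩ := exists_mul_cv L x
  apply zsmul_cancel L hN
  rw [← map_zsmul, ← map_zsmul, hz, matExt_cv, matExt_cv, h]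

theorem matExt_form (L : EvenLattice) (σ : (Fin L.n → ℤ) ≃ₗ[ℤ] (Fin L.n → ℤ))
    (h : ∀ x y, formR L ℤ (σ x) (σ y) = formR L ℤ x y) (x y : Fin L.n → ℚ) :
    formR L ℚ (matExt L σ x) (matExt L σ y) = formR L ℚ x y := by
  obtain ⟨N, hN, z, hz⟩ := exists_mul_cv L x
  obtain ⟨M, hM, w, hw⟩ := exists_mul_cv L y
  have hNM : (N * M : ℚ) ≠ 0 := by positivity
  apply mul_left_cancel₀ hNM
  rw [← form_zsmul, ← form_zsmul, ← map_zsmul, ← map_zsmul, hz, hw, matExt_cv, matExt_cv,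
    form_cv, form_cv, h]

theorem matExt_int (L : EvenLattice) (σ : (Fin L.n → ℤ) ≃ₗ[ℤ] (Fin L.n → ℤ))
    {x : Fin L.n → ℚ} (hx : x ∈ intSub L) : matExt L σ x ∈ intSub L := by
  obtain ⟨z, rfl⟩ := exists_cv L hx
  rw [matExt_cv]
  exact cv_mem L _

theorem matExt_dual (L : EvenLattice) (σ : (Fin L.n → ℤ) ≃ₗ[ℤ] (Fin L.n → ℤ))
    (h : ∀ x y, formR L ℤ (σ x) (σ y) = formR L ℤ x y)
    {x : Fin L.n → ℚ} (hx : x ∈ dualSub L) : matExt L σ x ∈ dualSub L := by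
  intro y hy
  obtain ⟨m, hm⟩ := hx (matExt L σ.symm y) (matExt_int L _ hy)
  refine ⟨m, ?_⟩
  rw [← hm, ← matExt_form L σ h x, matExt_symm L σ σ.symm (by simp)]

theorem symm_form (L : EvenLattice) (σ : (Fin L.n → ℤ) ≃ₗ[ℤ] (Fin L.n → ℤ))
    (h : ∀ x y, formR L ℤ (σ x) (σ y) = formR L ℤ x y) (x y) :
    formR L ℤ (σ.symm x) (σ.symm y) = formR L ℤ x y := by
  rw [← h]
  simp

/-- the induced automorphism of the dual -/
noncomputable def dualEquiv (L : EvenLattice) (σ : (Fin L.n → ℤ) ≃ₗ[ℤ] (Fin L.n → ℤ))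
    (h : ∀ x y, formR L ℤ (σ x) (σ y) = formR L ℤ x y) : dualSub L ≃+ dualSub L where
  toFun x := ⟨matExt L σ x, matExt_dual L σ h x.2⟩
  invFun x := ⟨matExt L σ.symm x, matExt_dual L σ.symm (symm_form L σ h) x.2⟩
  left_inv x := Subtype.ext (matExt_symm L σ.symm σ (by simp) _)
  right_inv x := Subtype.ext (matExt_symm L σ σ.symm (by simp) _)
  map_add' x y := Subtype.ext (by simp)

theorem mk_mem_over (L : EvenLattice) {K : AddSubgroup (Fin L.n → ℚ)} (hK : intSub L ≤ K)
    (x : dualSub L) :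
    (QuotientAddGroup.mk x : discGroup L) ∈ overToSub L K ↔ (x : Fin L.n → ℚ) ∈ K := by
  constructor
  · rintro ⟨y, hy, hxy⟩
    have h1 := QuotientAddGroup.eq.mp hxy
    have h2 : (-(y : Fin L.n → ℚ) + x) ∈ K := hK h1
    have h3 : (y : Fin L.n → ℚ) ∈ K := hy
    simpa using K.add_mem h3 h2
  · intro hx
    exact ⟨x, hx, rfl⟩

theorem le_dual (L : EvenLattice) {K : AddSubgroup (Fin L.n → ℚ)} (hK : IsEvenOverlattice L K) :
    K ≤ dualSub L := fun x hx y hy => hK.2.1 x hx y (hK.1 hy)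

theorem exists_sigma (L : EvenLattice) {K K' : AddSubgroup (Fin L.n → ℚ)}
    (hK : intSub L ≤ K) (hK' : intSub L ≤ K') (φ : K ≃+ K')
    (h : ∀ x : K, (x : Fin L.n → ℚ) ∈ intSub L ↔ (φ x : Fin L.n → ℚ) ∈ intSub L) :
    ∃ σ : (Fin L.n → ℤ) ≃ₗ[ℤ] (Fin L.n → ℤ),
      ∀ z, cv L (σ z) = φ ⟨cv L z, hK (cv_mem L z)⟩ := by
  have h1 : ∀ z, ∃ w, cv L w = φ ⟨cv L z, hK (cv_mem L z)⟩ :=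
    fun z => exists_cv L ((h _).mp (cv_mem L z))
  have h2 : ∀ z, ∃ w, cv L w = φ.symm ⟨cv L z, hK' (cv_mem L z)⟩ := by
    refine fun z => exists_cv L ((h _).mpr ?_)
    rw [φ.apply_symm_apply]
    exact cv_mem L z
  choose f hf using h1
  choose g hg using h2
  let e : (Fin L.n → ℤ) ≃+ (Fin L.n → ℤ) :=
    { toFun := f
      invFun := g
      left_inv := fun z => cv_inj L (by
        rw [hg]
        have : (⟨cv L (f z), hK' (cv_mem L _)⟩ : K') = φ ⟨cv L z, hK (cv_mem L z)⟩ :=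
          Subtype.ext (hf z)
        rw [this, φ.symm_apply_apply])
      right_inv := fun z => cv_inj L (by
        rw [hf]
        have : (⟨cv L (g z), hK (cv_mem L _)⟩ : K) = φ.symm ⟨cv L z, hK' (cv_mem L z)⟩ :=
          Subtype.ext (hg z)
        rw [this, φ.apply_symm_apply])
      map_add' := fun z w => cv_inj L (by
        rw [cv_add, hf, hf, hf, ← AddSubgroup.coe_add, ← map_add]
        congr 2
        exact Subtype.ext (cv_add L z w)) }
  exact ⟨e.toIntLinearEquiv, hf⟩

/-- **Isomorphism of overlattices.** Two even overlattices `K`, `K'` of `L`, with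
corresponding isotropic subgroups `C = K/L` and `C' = K'/L`, admit an isometry `K → K'`
mapping `L` onto `L` if and only if some self-isometry of `L` induces an isometry of the
discriminant form `(L^*/L, q_L)` carrying `C` onto `C'`. -/
theorem overlattices_isomorphic_iff_induced_isometry (L : EvenLattice)
    (K K' : AddSubgroup (Fin L.n → ℚ))
    (hK : IsEvenOverlattice L K) (hK' : IsEvenOverlattice L K') :
    (∃ φ : K ≃+ K',
        (∀ x y : K, formR L ℚ (φ x : Fin L.n → ℚ) (φ y : Fin L.n → ℚ) =
          formR L ℚ (x : Fin L.n → ℚ) (y : Fin L.n → ℚ)) ∧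
        (∀ x : K, (x : Fin L.n → ℚ) ∈ intSub L ↔ (φ x : Fin L.n → ℚ) ∈ intSub L)) ↔
    (∃ σ : (Fin L.n → ℤ) ≃ₗ[ℤ] (Fin L.n → ℤ),
        (∀ x y, formR L ℤ (σ x) (σ y) = formR L ℤ x y) ∧
        ∃ τ : discGroup L ≃+ discGroup L,
          (∀ (x : dualSub L) (hx : matExt L σ (x : Fin L.n → ℚ) ∈ dualSub L),
            τ (QuotientAddGroup.mk x) =
              QuotientAddGroup.mk (⟨matExt L σ (x : Fin L.n → ℚ), hx⟩ : dualSub L)) ∧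
          AddSubgroup.map τ.toAddMonoidHom (overToSub L K) = overToSub L K') := by
  constructor
  · rintro ⟨φ, hφ, hint⟩
    obtain ⟨σ, hσ⟩ := exists_sigma L hK.1 hK'.1 φ hint
    have hs : ∀ x y, formR L ℤ (σ x) (σ y) = formR L ℤ x y := by
      intro x y
      have : (formR L ℤ (σ x) (σ y) : ℚ) = formR L ℤ x y := by
        rw [← form_cv, ← form_cv, hσ, hσ, hφ]
      exact_mod_cast this
    have hext : ∀ x : K, matExt L σ x = φ x := by
      intro x
      obtain ⟨N, hN, z, hz⟩ := exists_mul_cv L x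
      apply zsmul_cancel L hN
      rw [← map_zsmul, hz, matExt_cv, hσ, ← AddSubgroup.coe_zsmul, ← map_zsmul]
      congr 2
      exact Subtype.ext hz.symm
    refine ⟨σ, hs, QuotientAddGroup.congr _ _ (dualEquiv L σ hs) ?_, fun x hx => rfl, ?_⟩
    · ext x
      constructor
      · rintro ⟨y, hy, rfl⟩
        exact matExt_int L σ hy
      · intro hx
        exact ⟨(dualEquiv L σ hs).symm x, matExt_int L σ.symm hx,
          (dualEquiv L σ hs).apply_symm_apply x⟩
    · ext a
      constructor
      · rintro ⟨b, hb, rfl⟩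
        obtain ⟨x, rfl⟩ := QuotientAddGroup.mk_surjective b
        have hx := (mk_mem_over L hK.1 x).mp hb
        refine (mk_mem_over L hK'.1 (dualEquiv L σ hs x)).mpr ?_
        change matExt L σ x ∈ K'
        rw [hext ⟨x, hx⟩]
        exact (φ _).2
      · intro ha
        obtain ⟨x, rfl⟩ := QuotientAddGroup.mk_surjective a
        have hx := (mk_mem_over L hK'.1 x).mp ha
        let y : K := φ.symm ⟨x, hx⟩
        have hy : matExt L σ y = x := by
          rw [hext, φ.apply_symm_apply]
        let y' : dualSub L := ⟨y, le_dual L hK y.2⟩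
        refine ⟨QuotientAddGroup.mk y', (mk_mem_over L hK.1 y').mpr y.2, ?_⟩
        change (QuotientAddGroup.mk (dualEquiv L σ hs y') : discGroup L) = _
        congr 1
        exact Subtype.ext hy
  · rintro ⟨σ, hs, τ, hτ, hmap⟩
    have key : ∀ x ∈ K, matExt L σ x ∈ K' := by
      intro x hx
      have hd := matExt_dual L σ hs (le_dual L hK hx)
      have h1 : τ (QuotientAddGroup.mk (⟨x, le_dual L hK hx⟩ : dualSub L)) ∈ overToSub L K' := by
        have h0 := (mk_mem_over L hK.1 ⟨x, le_dual L hK hx⟩).mpr hx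
        have h2 := AddSubgroup.mem_map_of_mem τ.toAddMonoidHom h0
        rw [hmap] at h2
        exact h2
      have h3 := hτ ⟨x, le_dual L hK hx⟩ hd
      rw [h3] at h1
      exact (mk_mem_over L hK'.1 ⟨matExt L σ x, hd⟩).mp h1
    have key' : ∀ x ∈ K', matExt L σ.symm x ∈ K := by
      intro x hx
      have h1 := (mk_mem_over L hK'.1 ⟨x, le_dual L hK' hx⟩).mpr hx
      rw [← hmap] at h1
      obtain ⟨b, hb, hbx⟩ := h1
      obtain ⟨y, rfl⟩ := QuotientAddGroup.mk_surjective b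
      have hy := (mk_mem_over L hK.1 y).mp hb
      have h2 : τ (QuotientAddGroup.mk y) =
        QuotientAddGroup.mk (⟨x, le_dual L hK' hx⟩ : dualSub L) := hbx
      rw [hτ y (matExt_dual L σ hs y.2)] at h2
      have h5 := QuotientAddGroup.eq.mp h2
      have h3 : -(matExt L σ y) + x ∈ intSub L := h5
      have h4 := hK.1 (matExt_int L σ.symm h3)
      rw [map_add, map_neg, matExt_symm L σ.symm σ (by simp)] at h4
      simpa using K.add_mem hy h4
    refine ⟨{ toFun := fun x => ⟨matExt L σ x, key x x.2⟩
              invFun := fun x => ⟨matExt L σ.symm x, key' x x.2⟩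
              left_inv := fun x => Subtype.ext (matExt_symm L σ.symm σ (by simp) _)
              right_inv := fun x => Subtype.ext (matExt_symm L σ σ.symm (by simp) _)
              map_add' := fun x y => Subtype.ext (by simp) }, ?_, ?_⟩
    · intro x y
      exact matExt_form L σ hs x y
    · intro x
      refine ⟨fun h => matExt_int L σ h, fun h => ?_⟩
      have := matExt_int L σ.symm h
      change matExt L σ.symm (matExt L σ x) ∈ _ at this
      rwa [matExt_symm L σ.symm σ (by simp)] at this
end
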